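/- arXiv:1904.09253 — 3 statements merged into one kernel-verified Lean document; each statement's English description precedes it below -/
import Mathlib

section
/- Let L = D^{n+1} + Σ_{i=0}^n a_i D^i have characteristic polynomial p_L with at least one nonreal (complex) root, and let M_L be the maximum of the imaginary parts of the complex roots of p_L. Then for every h with 0 < h < π/M_L, the restriction of the kernel E_L to [0,h] is an EC-space on [0,h]; in particular the critical length satisfies ℓ_L ≥ π/M_L. -/
open scoped BigOperators

noncomputable section

/-- `F` vanishes to order at least `m` at `x`: all derivatives of order `< m` vanish at `x`. -/
def VanishAtLeast (F : ℝ → ℝ) (m : ℕ) (x : ℝ) : Prop :=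
  ∀ j < m, iteratedDeriv j F x = 0

/-- `F` vanishes at most `N` times in `J`, counting multiplicities up to `μ`. -/
def VanishAtMost (F : ℝ → ℝ) (μ N : ℕ) (J : Set ℝ) : Prop :=
  ∀ (r : ℕ) (xs : Fin r → ℝ) (m : Fin r → ℕ),
    (∀ i, xs i ∈ J) → Function.Injective xs →
    (∀ i, 1 ≤ m i) → (∀ i, m i ≤ μ) →
    (∀ i, VanishAtLeast F (m i) (xs i)) →
    ∑ i, m i ≤ N

/-- Kernel of the operator `L = D^(n+1) + ∑_{i=0}^n a i • D^i`. -/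
def kerOp (n : ℕ) (a : Fin (n + 1) → ℝ) : Set (ℝ → ℝ) :=
  {F | ContDiff ℝ (⊤ : ℕ∞) F ∧
    ∀ x : ℝ, iteratedDeriv (n + 1) F x + ∑ i : Fin (n + 1), a i * iteratedDeriv (i : ℕ) F x = 0}

/-- The (restriction of the) kernel of `L` is an Extended Chebyshev space on `J`. -/
def IsECOn (n : ℕ) (a : Fin (n + 1) → ℝ) (J : Set ℝ) : Prop :=
  ∀ F ∈ kerOp n a, F ≠ 0 → VanishAtMost F (n + 1) n J

/-- Critical length of the operator `L = D^(n+1) + ∑ a i • D^i`, as an extended real. -/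
def critLen (n : ℕ) (a : Fin (n + 1) → ℝ) : EReal :=
  sSup {l : EReal | ∃ h : ℝ, l = (h : EReal) ∧ 0 < h ∧ IsECOn n a (Set.Icc 0 h)}


/-- `F` has at least `N` zeros with multiplicities in `(c, d)`. -/
def HasZeros (c d : ℝ) (F : ℝ → ℝ) (N : ℕ) : Prop :=
  ∃ (S : Finset ℝ) (m : ℝ → ℕ), (∀ x ∈ S, x ∈ Set.Ioo c d) ∧
    (∀ x ∈ S, VanishAtLeast F (m x) x) ∧ N ≤ ∑ x ∈ S, m x

/-- `G = F' - v F` on `(c, d)`, where `v = u' / u` for a positive function `u`. -/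
structure StepRel (c d : ℝ) (F G u v : ℝ → ℝ) : Prop where
  smoothF : ContDiffOn ℝ (⊤ : ℕ∞) F (Set.Ioo c d)
  smoothv : ContDiffOn ℝ (⊤ : ℕ∞) v (Set.Ioo c d)
  upos : ∀ x ∈ Set.Ioo c d, 0 < u x
  derivu : ∀ x ∈ Set.Ioo c d, HasDerivAt u (v x * u x) x
  eqG : ∀ x ∈ Set.Ioo c d, G x = deriv F x - v x * F x

/-- `F` is annihilated on `(c, d)` by a composition of `N` first order operators. -/
inductive Chain (c d : ℝ) : ℕ → (ℝ → ℝ) → Prop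
  | zero (F : ℝ → ℝ) (h : ∀ x ∈ Set.Ioo c d, F x = 0) : Chain c d 0 F
  | succ (N : ℕ) (F G u v : ℝ → ℝ) (h : StepRel c d F G u v) (hG : Chain c d N G) :
      Chain c d (N + 1) F

lemma vanish_mul {F v : ℝ → ℝ} {m : ℕ} {x : ℝ} (hF : ContDiffAt ℝ (⊤ : ℕ∞) F x)
    (hv : ContDiffAt ℝ (⊤ : ℕ∞) v x) (h : VanishAtLeast F m x) : VanishAtLeast (v * F) m x := by
  intro j hj
  rw [iteratedDeriv_mul (hv.of_le (by exact_mod_cast le_top)) (hF.of_le (by exact_mod_cast le_top))]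
  refine Finset.sum_eq_zero fun i hi => ?_
  rw [h (j - i) (by omega), mul_zero]

lemma StepRel.contDiffAt {c d : ℝ} {F G u v : ℝ → ℝ} (h : StepRel c d F G u v) {x : ℝ}
    (hx : x ∈ Set.Ioo c d) : ContDiffAt ℝ (⊤ : ℕ∞) F x :=
  h.smoothF.contDiffAt (isOpen_Ioo.mem_nhds hx)

lemma StepRel.quot {c d : ℝ} {F G u v : ℝ → ℝ} (h : StepRel c d F G u v) {x : ℝ}
    (hx : x ∈ Set.Ioo c d) : HasDerivAt (fun y => F y / u y) (G x / u x) x := by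
  have hF : HasDerivAt F (deriv F x) x :=
    ((h.contDiffAt hx).differentiableAt (by simp)).hasDerivAt
  have hu := h.derivu x hx
  have hp := (h.upos x hx).ne'
  have he : G x / u x = (deriv F x * u x - F x * (v x * u x)) / u x ^ 2 := by
    rw [h.eqG x hx]
    field_simp
  rw [he]
  exact hF.div hu hp

lemma StepRel.vanish {c d : ℝ} {F G u v : ℝ → ℝ} (h : StepRel c d F G u v) {x : ℝ}
    (hx : x ∈ Set.Ioo c d) {m : ℕ} (hm : VanishAtLeast F m x) : VanishAtLeast G (m - 1) x := by
  intro j hj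
  have hF := h.contDiffAt hx
  have hv : ContDiffAt ℝ (⊤ : ℕ∞) v x := h.smoothv.contDiffAt (isOpen_Ioo.mem_nhds hx)
  have he : G =ᶠ[nhds x] (deriv F - v * F) := by
    filter_upwards [isOpen_Ioo.mem_nhds hx] with y hy
    simpa using h.eqG y hy
  have hd : ContDiffAt ℝ (j : ℕ) (deriv F) x := by
    have : ContDiffAt ℝ ((j + 1 : ℕ)) F x := hF.of_le (by exact_mod_cast le_top)
    exact this.derivWithin (by norm_cast)
  have hvF : ContDiffAt ℝ (j : ℕ) (v * F) x := (hv.mul hF).of_le (by exact_mod_cast le_top)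
  rw [he.iteratedDeriv_eq, iteratedDeriv_sub hd hvF,
    ← iteratedDeriv_succ', hm (j + 1) (by omega), vanish_mul hF hv hm j (by omega), sub_zero]

lemma StepRel.rolle {c d : ℝ} {F G u v : ℝ → ℝ} (h : StepRel c d F G u v) {x y : ℝ}
    (hx : x ∈ Set.Ioo c d) (hy : y ∈ Set.Ioo c d) (hxy : x < y) (hFx : F x = 0) (hFy : F y = 0) :
    ∃ z ∈ Set.Ioo x y, G z = 0 := by
  have hsub : Set.Icc x y ⊆ Set.Ioo c d := fun z hz => ⟨hx.1.trans_le hz.1, hz.2.trans_lt hy.2⟩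
  obtain ⟨z, hz, hz0⟩ := exists_hasDerivAt_eq_zero (f := fun y => F y / u y)
    (f' := fun y => G y / u y) hxy
    (fun z hz => (h.quot (hsub hz)).continuousAt.continuousWithinAt) (by simp [hFx, hFy])
    (fun z hz => h.quot (hsub ⟨hz.1.le, hz.2.le⟩))
  refine ⟨z, hz, ?_⟩
  have hp := (h.upos z (hsub ⟨hz.1.le, hz.2.le⟩)).ne'
  simpa [hp] using hz0

lemma StepRel.hasZeros {c d : ℝ} {F G u v : ℝ → ℝ} (h : StepRel c d F G u v) {N : ℕ}
    (hz : HasZeros c d F (N + 1)) : HasZeros c d G N := by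
  classical
  obtain ⟨S0, m, hS0, hm0, hN0⟩ := hz
  obtain ⟨S, hS, hm, hm1, hN⟩ : ∃ S : Finset ℝ, (∀ x ∈ S, x ∈ Set.Ioo c d) ∧
      (∀ x ∈ S, VanishAtLeast F (m x) x) ∧ (∀ x ∈ S, 1 ≤ m x) ∧ N + 1 ≤ ∑ x ∈ S, m x := by
    refine ⟨S0.filter (fun x => m x ≠ 0), fun x hx => hS0 x (Finset.mem_filter.1 hx).1,
      fun x hx => hm0 x (Finset.mem_filter.1 hx).1,
      fun x hx => Nat.one_le_iff_ne_zero.2 (Finset.mem_filter.1 hx).2, ?_⟩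
    rwa [Finset.sum_filter_ne_zero]
  have hF0 : ∀ x ∈ S, F x = 0 := fun x hx => by
    simpa using hm x hx 0 (hm1 x hx)
  have key : ∀ p : ℝ × ℝ, ∃ z, (p.1 ∈ S ∧ p.2 ∈ S ∧ p.1 < p.2) →
      z ∈ Set.Ioo p.1 p.2 ∧ G z = 0 := by
    intro p
    by_cases hp : p.1 ∈ S ∧ p.2 ∈ S ∧ p.1 < p.2
    · obtain ⟨z, hz, hz0⟩ := h.rolle (hS _ hp.1) (hS _ hp.2.1) hp.2.2 (hF0 _ hp.1) (hF0 _ hp.2.1)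
      exact ⟨z, fun _ => ⟨hz, hz0⟩⟩
    · exact ⟨0, fun h => absurd h hp⟩
  choose f hf using key
  set T : Finset ℝ := ((S ×ˢ S).filter (fun p => p.1 < p.2)).image f with hT
  have hTm : ∀ z ∈ T, z ∈ Set.Ioo c d ∧ G z = 0 := by
    intro z hz
    obtain ⟨p, hp, rfl⟩ := Finset.mem_image.1 hz
    rw [Finset.mem_filter, Finset.mem_product] at hp
    have := hf p ⟨hp.1.1, hp.1.2, hp.2⟩
    exact ⟨⟨(hS _ hp.1.1).1.trans this.1.1, this.1.2.trans (hS _ hp.1.2).2⟩, this.2⟩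
  have hcard : S.card ≤ (T \ S).card + 1 := by
    refine Finset.card_le_sdiff_of_interleaved fun x hx y hy hxy _ => ?_
    have := hf (x, y) ⟨hx, hy, hxy⟩
    refine ⟨f (x, y), ?_, this.1.1, this.1.2⟩
    refine Finset.mem_image_of_mem _ ?_
    simp [hx, hy, hxy]
  refine ⟨S ∪ (T \ S), fun x => if x ∈ S then m x - 1 else 1, ?_, ?_, ?_⟩
  · intro x hx
    rcases Finset.mem_union.1 hx with hx | hx
    · exact hS x hx
    · exact (hTm x (Finset.mem_sdiff.1 hx).1).1
  · intro x hx
    rcases Finset.mem_union.1 hx with hx | hx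
    · simp only [hx, if_true]
      exact h.vanish (hS x hx) (hm x hx)
    · rw [Finset.mem_sdiff] at hx
      simp only [hx.2, if_false]
      intro j hj
      obtain rfl : j = 0 := by omega
      simpa using (hTm x hx.1).2
  · rw [Finset.sum_union Finset.disjoint_sdiff]
    have h1 : ∑ x ∈ S, (if x ∈ S then m x - 1 else 1) + S.card = ∑ x ∈ S, m x := by
      rw [Finset.card_eq_sum_ones, ← Finset.sum_add_distrib]
      refine Finset.sum_congr rfl fun x hx => ?_
      have := hm1 x hx
      simp only [hx, if_true]
      omega
    have h2 : ∑ x ∈ T \ S, (if x ∈ S then m x - 1 else 1) = (T \ S).card := by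
      rw [Finset.card_eq_sum_ones]
      refine Finset.sum_congr rfl fun x hx => ?_
      simp [(Finset.mem_sdiff.1 hx).2]
    omega

lemma Chain.eq_zero {c d : ℝ} {N : ℕ} {F : ℝ → ℝ} (h : Chain c d N F) :
    HasZeros c d F N → ∀ x ∈ Set.Ioo c d, F x = 0 := by
  induction h with
  | zero F h => exact fun _ => h
  | succ N F G u v h hG ih =>
    intro hz
    have hG0 := ih (h.hasZeros hz)
    obtain ⟨S, m, hS, hm, hN⟩ := hz
    obtain ⟨y, hy, hy0⟩ : ∃ y ∈ Set.Ioo c d, F y = 0 := by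
      by_contra hcon
      push Not at hcon
      have : ∑ x ∈ S, m x = 0 := by
        refine Finset.sum_eq_zero fun x hx => ?_
        by_contra hmx
        exact hcon x (hS x hx) (by simpa using hm x hx 0 (Nat.pos_of_ne_zero hmx))
      omega
    intro x hx
    have := isOpen_Ioo.is_const_of_deriv_eq_zero (𝕜 := ℝ) isPreconnected_Ioo
      (f := fun y => F y / u y)
      (fun z hz => (h.quot hz).differentiableAt.differentiableWithinAt)
      (fun z hz => by rw [(h.quot hz).deriv, hG0 z hz]; simp) hx hy
    have hp := (h.upos x hx).ne'
    simpa [hy0, hp] using this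

/-- The space of smooth functions. -/
def SmoothFn : Submodule ℝ (ℝ → ℝ) where
  carrier := {F | ContDiff ℝ (⊤ : ℕ∞) F}
  add_mem' := by
    intro F G hF hG
    rw [Set.mem_ofPred_eq] at *
    exact hF.add hG
  zero_mem' := by
    rw [Set.mem_ofPred_eq]
    exact contDiff_const
  smul_mem' := by
    intro c F hF
    rw [Set.mem_ofPred_eq] at *
    exact hF.const_smul c

lemma SmoothFn.smooth (F : SmoothFn) : ContDiff ℝ (⊤ : ℕ∞) F.1 := F.2

lemma SmoothFn.diff (F : SmoothFn) : Differentiable ℝ F.1 :=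
  (SmoothFn.smooth F).differentiable (by simp)

/-- Differentiation on smooth functions. -/
def DOp : SmoothFn →ₗ[ℝ] SmoothFn where
  toFun F := ⟨deriv F.1, ((contDiff_infty_iff_deriv (𝕜 := ℝ)).1 (SmoothFn.smooth F)).2⟩
  map_add' F G := by
    apply Subtype.ext
    funext x
    exact deriv_add (SmoothFn.diff F x) (SmoothFn.diff G x)
  map_smul' c F := by
    apply Subtype.ext
    funext x
    exact deriv_const_smul c (SmoothFn.diff F x)

lemma DOp_coe (F : SmoothFn) : (DOp F).1 = deriv F.1 := rfl

lemma DOp_pow (k : ℕ) (F : SmoothFn) : ((DOp ^ k) F).1 = iteratedDeriv k F.1 := by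
  induction k with
  | zero => simp
  | succ k ih =>
    rw [pow_succ', Module.End.mul_apply, DOp_coe, ih, iteratedDeriv_succ]

lemma chain_linear {c d : ℝ} (F : SmoothFn) (l : ℝ) (N : ℕ)
    (h : Chain c d N (DOp F - l • F).1) : Chain c d (N + 1) F.1 := by
  refine Chain.succ N F.1 _ (fun x => Real.exp (l * x)) (fun _ => l) ?_ h
  refine ⟨(SmoothFn.smooth F).contDiffOn, contDiffOn_const, fun x _ => Real.exp_pos _, ?_, ?_⟩
  · intro x _
    have h1 : HasDerivAt (fun x : ℝ => l * x) l x := by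
      simpa using (hasDerivAt_id x).const_mul l
    simpa [mul_comm] using h1.exp
  · intro x _
    rfl

lemma chain_quad {c d : ℝ} (F : SmoothFn) (α β : ℝ) (hβ : 0 < β) (hb : β * (d - c) ≤ Real.pi)
    (N : ℕ) (h : Chain c d N (DOp (DOp F) - (2 * α) • DOp F + (α ^ 2 + β ^ 2) • F).1) :
    Chain c d (N + 2) F.1 := by
  set s : ℝ → ℝ := fun x => Real.sin (β * (x - c)) with hs
  set k : ℝ → ℝ := fun x => Real.cos (β * (x - c)) with hk
  have hspos : ∀ x ∈ Set.Ioo c d, 0 < s x := by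
    intro x hx
    refine Real.sin_pos_of_pos_of_lt_pi (mul_pos hβ (sub_pos.2 hx.1)) ?_
    have : β * (x - c) < β * (d - c) := mul_lt_mul_of_pos_left (by linarith [hx.2]) hβ
    linarith
  have hlin : ∀ x : ℝ, HasDerivAt (fun x : ℝ => β * (x - c)) β x := by
    intro x
    simpa using ((hasDerivAt_id x).sub_const c).const_mul β
  have hsd : ∀ x, HasDerivAt s (k x * β) x := fun x => (hlin x).sin
  have hkd : ∀ x, HasDerivAt k (-s x * β) x := fun x => (hlin x).cos
  have hsc : ContDiff ℝ (⊤ : ℕ∞) s := by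
    rw [hs]; fun_prop
  have hkc : ContDiff ℝ (⊤ : ℕ∞) k := by
    rw [hk]; fun_prop
  have hed : ∀ x : ℝ, HasDerivAt (fun x : ℝ => Real.exp (α * x)) (Real.exp (α * x) * α) x := by
    intro x
    have h1 : HasDerivAt (fun x : ℝ => α * x) α x := by
      simpa using (hasDerivAt_id x).const_mul α
    exact h1.exp
  have hq : ContDiffOn ℝ (⊤ : ℕ∞) (fun x => k x / s x) (Set.Ioo c d) :=
    hkc.contDiffOn.div hsc.contDiffOn fun x hx => (hspos x hx).ne'
  set v : ℝ → ℝ := fun x => α + β * (k x / s x) with hv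
  set w : ℝ → ℝ := fun x => α - β * (k x / s x) with hw
  have hvc : ContDiffOn ℝ (⊤ : ℕ∞) v (Set.Ioo c d) :=
    contDiffOn_const.add (contDiffOn_const.mul hq)
  have hwc : ContDiffOn ℝ (⊤ : ℕ∞) w (Set.Ioo c d) :=
    contDiffOn_const.sub (contDiffOn_const.mul hq)
  set G : ℝ → ℝ := fun x => deriv F.1 x - v x * F.1 x with hG
  have hDF : ContDiff ℝ (⊤ : ℕ∞) (deriv F.1) := SmoothFn.smooth (DOp F)
  have hcirc : ∀ x, s x ^ 2 + k x ^ 2 = 1 := fun x => Real.sin_sq_add_cos_sq _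
  refine Chain.succ (N + 1) F.1 G (fun x => Real.exp (α * x) * s x) v ?_
    (Chain.succ N G _ (fun x => Real.exp (α * x) / s x) w ?_ h)
  · refine ⟨(SmoothFn.smooth F).contDiffOn, hvc,
      fun x hx => mul_pos (Real.exp_pos _) (hspos x hx), ?_, fun x _ => rfl⟩
    intro x hx
    have hp := (hspos x hx).ne'
    refine ((hed x).mul (hsd x)).congr_deriv ?_
    simp only [hv]
    field_simp
  · refine ⟨hDF.contDiffOn.sub (hvc.mul (SmoothFn.smooth F).contDiffOn), hwc,
      fun x hx => div_pos (Real.exp_pos _) (hspos x hx), ?_, ?_⟩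
    · intro x hx
      have hp := (hspos x hx).ne'
      refine ((hed x).div (hsd x) hp).congr_deriv ?_
      simp only [hw]
      field_simp
    · intro x hx
      have hp := (hspos x hx).ne'
      have hF1 : HasDerivAt F.1 (deriv F.1 x) x := (SmoothFn.diff F x).hasDerivAt
      have hF2 : HasDerivAt (deriv F.1) (deriv (deriv F.1) x) x :=
        (SmoothFn.diff (DOp F) x).hasDerivAt
      have hvd : HasDerivAt v (β * ((-s x * β * s x - k x * (k x * β)) / s x ^ 2)) x :=
        (((hkd x).div (hsd x) hp).const_mul β).const_add α
      have hGd : HasDerivAt G _ x := hF2.sub (hvd.mul hF1)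
      rw [hGd.deriv]
      change deriv (deriv F.1) x - (2 * α) * deriv F.1 x + (α ^ 2 + β ^ 2) * F.1 x = _
      simp only [hG, hv, hw]
      have hc := hcirc x
      have hc' : k x ^ 2 = 1 - s x ^ 2 := by linarith
      field_simp
      ring_nf
      try simp only [hc']
      try ring

open Polynomial in
lemma chain_of_poly {c d : ℝ} (N : ℕ) : ∀ (p : ℝ[X]) (F : SmoothFn), p.Monic →
    p.natDegree = N → (∀ z : ℂ, aeval z p = 0 → z.im * (d - c) ≤ Real.pi) →
    aeval DOp p F = 0 → Chain c d N F.1 := by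
  induction N using Nat.strong_induction_on with
  | _ N ih =>
  intro p F hp hN hz hF
  rcases Nat.eq_zero_or_pos N with rfl | hpos
  · rw [hp.natDegree_eq_zero.1 hN] at hF
    refine Chain.zero _ fun x _ => ?_
    have : F = 0 := by simpa using hF
    simp [this]
  · obtain ⟨z0, hz0⟩ : ∃ z : ℂ, aeval z p = 0 :=
      IsAlgClosed.exists_aeval_eq_zero ℂ p (by
        rw [degree_eq_natDegree hp.ne_zero, hN]; exact_mod_cast hpos.ne')
    by_cases him : z0.im = 0
    · have hr : p.IsRoot z0.re := by
        have : z0 = (algebraMap ℝ ℂ z0.re) := by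
          apply Complex.ext <;> simp [him]
        rw [this, aeval_algebraMap_apply] at hz0
        simpa using hz0
      obtain ⟨q, rfl⟩ := dvd_iff_isRoot.2 hr
      have hq : q.Monic := (monic_X_sub_C z0.re).of_mul_monic_left hp
      rw [(monic_X_sub_C z0.re).natDegree_mul hq, natDegree_X_sub_C] at hN
      obtain ⟨K, rfl⟩ : ∃ K, N = K + 1 := ⟨N - 1, by omega⟩
      refine chain_linear F z0.re K (ih K (by omega) q _ hq (by omega) ?_ ?_)
      · intro z h0
        exact hz z (by rw [map_mul, h0, mul_zero])
      · rw [mul_comm, map_mul, Module.End.mul_apply] at hF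
        simpa using hF
    · obtain ⟨z, hz0, him⟩ : ∃ z : ℂ, aeval z p = 0 ∧ 0 < z.im := by
        rcases lt_or_gt_of_ne him with h | h
        · refine ⟨starRingEnd ℂ z0, ?_, by simpa using h⟩
          rw [aeval_conj, hz0, map_zero]
        · exact ⟨z0, hz0, h⟩
      have hb := hz z hz0
      obtain ⟨q, rfl⟩ := p.quadratic_dvd_of_aeval_eq_zero_im_ne_zero hz0 him.ne'
      have hQ : (X ^ 2 - C (2 * z.re) * X + C (‖z‖ ^ 2) : ℝ[X]).Monic := by monicity!
      have hQd : (X ^ 2 - C (2 * z.re) * X + C (‖z‖ ^ 2) : ℝ[X]).natDegree = 2 := by compute_degree!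
      have hq : q.Monic := hQ.of_mul_monic_left hp
      rw [hQ.natDegree_mul hq, hQd] at hN
      obtain ⟨K, rfl⟩ : ∃ K, N = K + 2 := ⟨N - 2, by omega⟩
      refine chain_quad F z.re z.im him hb K (ih K (by omega) q _ hq (by omega) ?_ ?_)
      · intro z h0
        exact hz z (by rw [map_mul, h0, mul_zero])
      · have hn : z.re ^ 2 + z.im ^ 2 = ‖z‖ ^ 2 := by
          rw [Complex.sq_norm, Complex.normSq_apply]; ring
        rw [mul_comm, map_mul, Module.End.mul_apply] at hF
        rw [hn]
        convert hF using 2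
        simp only [map_add, map_sub, map_mul, aeval_X, aeval_C, LinearMap.add_apply,
          LinearMap.sub_apply, Module.End.mul_apply, Module.algebraMap_end_apply, pow_two]
        simp only [mul_smul]

lemma global_zero {F : ℝ → ℝ} {N : ℕ} {δ : ℝ} (hδ : 0 < δ)
    (hch : ∀ c d : ℝ, c < d → d - c ≤ δ → Chain c d N F) {c d : ℝ} (hcd : c < d)
    (hlen : d - c ≤ δ) (hz : HasZeros c d F N) : F = 0 := by
  have h0 := (hch c d hcd hlen).eq_zero hz
  set A : Set ℝ := {x | ∀ᶠ y in nhds x, F y = 0} with hA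
  have hopen : IsOpen A := isOpen_setOfPred_eventually_nhds
  have hclosed : IsClosed A := by
    refine isClosed_of_closure_subset fun x hx => ?_
    have hxI : x ∈ Set.Ioo (x - δ / 2) (x + δ / 2) := ⟨by linarith, by linarith⟩
    obtain ⟨y, hyI, hy⟩ := mem_closure_iff.1 hx _ isOpen_Ioo hxI
    have hzy : HasZeros (x - δ / 2) (x + δ / 2) F N := by
      refine ⟨{y}, fun _ => N, by simpa using hyI, ?_, by simp⟩
      intro t ht j _
      rw [Finset.mem_singleton.1 ht]
      have : F =ᶠ[nhds y] (fun _ => (0 : ℝ)) := hy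
      rw [this.iteratedDeriv_eq]
      simp
    have := (hch _ _ (by linarith) (by linarith)).eq_zero hzy
    filter_upwards [isOpen_Ioo.mem_nhds hxI] with t ht using this t ht
  have hne : A.Nonempty := by
    refine ⟨(c + d) / 2, ?_⟩
    filter_upwards [isOpen_Ioo.mem_nhds (show (c + d) / 2 ∈ Set.Ioo c d from
      ⟨by linarith, by linarith⟩)] with t ht using h0 t ht
  have huniv : A = Set.univ := IsClopen.eq_univ ⟨hclosed, hopen⟩ hne
  funext x
  have hx : x ∈ A := by rw [huniv]; trivial
  exact Filter.Eventually.self_of_nhds (p := fun y => F y = 0) hx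

/-- The characteristic polynomial. -/
def charP (n : ℕ) (a : Fin (n + 1) → ℝ) : Polynomial ℝ :=
  Polynomial.X ^ (n + 1) + ∑ i : Fin (n + 1), Polynomial.C (a i) * Polynomial.X ^ (i : ℕ)

lemma charP_degree_lt (n : ℕ) (a : Fin (n + 1) → ℝ) :
    (∑ i : Fin (n + 1), Polynomial.C (a i) * Polynomial.X ^ (i : ℕ)).degree
      < ((n + 1 : ℕ) : WithBot ℕ) :=
  Polynomial.degree_sum_fin_lt a

lemma charP_monic (n : ℕ) (a : Fin (n + 1) → ℝ) : (charP n a).Monic :=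
  Polynomial.monic_X_pow_add (charP_degree_lt n a)

lemma charP_natDegree (n : ℕ) (a : Fin (n + 1) → ℝ) : (charP n a).natDegree = n + 1 := by
  refine Polynomial.natDegree_eq_of_degree_eq_some ?_
  rw [charP, Polynomial.degree_add_eq_left_of_degree_lt, Polynomial.degree_X_pow]
  rw [Polynomial.degree_X_pow]
  exact charP_degree_lt n a

/-- if the characteristic polynomial of `L` has a nonreal root and `M_L` is the
maximum imaginary part of its complex roots, then for every `0 < h < π / M_L` the restriction
of `ker L` to `[0,h]` is an EC-space on `[0,h]`; in particular `ℓ_L ≥ π / M_L`. -/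
theorem stmt1 (n : ℕ) (a : Fin (n + 1) → ℝ)
    (hnonreal : ∃ z : ℂ,
      z ^ (n + 1) + ∑ i : Fin (n + 1), (a i : ℂ) * z ^ (i : ℕ) = 0 ∧ z.im ≠ 0)
    (M : ℝ)
    (hM : M = sSup {y : ℝ | ∃ z : ℂ,
      z ^ (n + 1) + ∑ i : Fin (n + 1), (a i : ℂ) * z ^ (i : ℕ) = 0 ∧ z.im = y}) :
    (∀ h : ℝ, 0 < h → h < Real.pi / M → IsECOn n a (Set.Icc 0 h)) ∧
    ((Real.pi / M : ℝ) : EReal) ≤ critLen n a := by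
  set p : Polynomial ℝ := charP n a with hpdef
  have hroot : ∀ z : ℂ, Polynomial.aeval z p =
      z ^ (n + 1) + ∑ i : Fin (n + 1), (a i : ℂ) * z ^ (i : ℕ) := by
    intro z
    simp [hpdef, charP]
  have hpm : p.Monic := charP_monic n a
  have hpd : p.natDegree = n + 1 := charP_natDegree n a
  set R : Set ℝ := {y : ℝ | ∃ z : ℂ,
      z ^ (n + 1) + ∑ i : Fin (n + 1), (a i : ℂ) * z ^ (i : ℕ) = 0 ∧ z.im = y} with hR
  have hbdd : BddAbove R := by
    have hfin : (Complex.im '' (p.rootSet ℂ)).Finite := (p.rootSet_finite ℂ).image _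
    refine hfin.bddAbove.mono ?_
    rintro y ⟨z, hz, rfl⟩
    refine ⟨z, ?_, rfl⟩
    rw [Polynomial.mem_rootSet]
    exact ⟨hpm.ne_zero, by rw [hroot, hz]⟩
  have hle : ∀ z : ℂ, Polynomial.aeval z p = 0 → z.im ≤ M := by
    intro z hz
    rw [hM]
    exact le_csSup hbdd ⟨z, by rw [← hroot, hz], rfl⟩
  have hMpos : 0 < M := by
    obtain ⟨z, hz, him⟩ := hnonreal
    rw [← hroot] at hz
    rcases lt_or_gt_of_ne him with h | h
    · have := hle (starRingEnd ℂ z) (by rw [Polynomial.aeval_conj, hz, map_zero])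
      simp only [Complex.conj_im] at this
      linarith
    · exact h.trans_le (hle z hz)
  have hmain : ∀ h : ℝ, 0 < h → h < Real.pi / M → IsECOn n a (Set.Icc 0 h) := by
    intro h h0 hh F hF hF0 r xs m hxs hinj hm1 hmn hv
    by_contra hcon
    push Not at hcon
    apply hF0
    obtain ⟨hFs, hFe⟩ := hF
    have hch : ∀ c d : ℝ, c < d → d - c ≤ Real.pi / M → Chain c d (n + 1) F := by
      intro c d hcd hlen
      refine chain_of_poly (n + 1) p ⟨F, hFs⟩ hpm hpd ?_ ?_
      · intro z hz
        calc z.im * (d - c) ≤ M * (d - c) :=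
              mul_le_mul_of_nonneg_right (hle z hz) (by linarith)
          _ ≤ M * (Real.pi / M) := mul_le_mul_of_nonneg_left hlen hMpos.le
          _ = Real.pi := by field_simp
      · apply Subtype.ext
        funext x
        have := hFe x
        rw [hpdef, charP]
        simp only [map_add, map_sum, map_mul, map_pow, Polynomial.aeval_X, Polynomial.aeval_C,
          LinearMap.add_apply, LinearMap.sum_apply, Module.End.mul_apply,
          Module.algebraMap_end_apply]
        simpa [DOp_pow] using this
    set e : ℝ := (Real.pi / M - h) / 2 with he
    have hepos : 0 < e := by rw [he]; linarith
    refine global_zero (δ := Real.pi / M) (by positivity) hch (c := -e) (d := h + e)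
      (by linarith) (by rw [he]; linarith) ?_
    classical
    refine ⟨Finset.univ.image xs, fun x => if hx : ∃ i, xs i = x then m hx.choose else 0,
      ?_, ?_, ?_⟩
    · intro x hx
      obtain ⟨i, -, rfl⟩ := Finset.mem_image.1 hx
      exact ⟨by linarith [(hxs i).1], by linarith [(hxs i).2]⟩
    · intro x hx
      obtain ⟨i, -, rfl⟩ := Finset.mem_image.1 hx
      have hex : ∃ j, xs j = xs i := ⟨i, rfl⟩
      beta_reduce
      rw [dif_pos hex, hinj hex.choose_spec]
      exact hv i
    · rw [Finset.sum_image fun i _ j _ hij => hinj hij]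
      refine hcon.trans_eq (Finset.sum_congr rfl fun i _ => ?_)
      have hex : ∃ j, xs j = xs i := ⟨i, rfl⟩
      rw [dif_pos hex, hinj hex.choose_spec]
  refine ⟨hmain, ?_⟩
  have hpi : 0 < Real.pi / M := by positivity
  refine le_of_forall_lt fun l hl => ?_
  obtain ⟨h, hlh, hh⟩ := EReal.lt_iff_exists_real_btwn.1 (max_lt hl (EReal.coe_pos.2 hpi))
  have h1 := (le_max_left _ _).trans_lt hlh
  have h2 : (0 : EReal) < h := (le_max_right _ _).trans_lt hlh
  have h2' : 0 < h := by exact_mod_cast h2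
  exact h1.trans_le (le_sSup ⟨h, rfl, h2', hmain h h2' (by exact_mod_cast hh)⟩)
end
end

section
/- Let L = D^{n+1} + Σ_{i=0}^n a_i D^i have characteristic polynomial p_L with at least one nonreal root. Then the critical length ℓ_L is finite (0 < ℓ_L < +∞) and the restriction of E_L to the closed interval [0, ℓ_L] is NOT an EC-space on [0, ℓ_L]: there exists a nonzero F ∈ E_L vanishing at least n+1 times in [0, ℓ_L] counting multiplicities up to n+1. -/
open scoped BigOperators

noncomputable section

def NodeV (G : ℕ → ℝ → ℝ) (N : ℕ) (x : ℕ → ℝ) : Prop :=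
  (∀ i j, i ≤ j → j < N → x i ≤ x j) ∧
  ∀ i j, i ≤ j → j < N → x i = x j → G (j - i) (x i) = 0

lemma nodeV_rolle (G : ℕ → ℝ → ℝ) (hG : ∀ j x, HasDerivAt (G j) (G (j+1) x) x)
    (m : ℕ) (x : ℕ → ℝ) (h : NodeV G (m+2) x) :
    ∃ y, NodeV (fun j => G (j+1)) (m+1) y ∧ x 0 ≤ y 0 ∧ y m ≤ x (m+1) := by
  obtain ⟨h1, h2⟩ := h
  have key : ∀ i, ∃ y, i < m + 1 → (x i = x (i+1) ∧ y = x i) ∨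
      (x i < y ∧ y < x (i+1) ∧ G 1 y = 0) := by
    intro i
    by_cases hi : i < m + 1
    · rcases (h1 i (i+1) (by omega) (by omega)).eq_or_lt with he | hl
      · exact ⟨x i, fun _ => Or.inl ⟨he, rfl⟩⟩
      · have e1 : G 0 (x i) = 0 := by simpa using h2 i i le_rfl (by omega) rfl
        have e2 : G 0 (x (i+1)) = 0 := by simpa using h2 (i+1) (i+1) le_rfl (by omega) rfl
        obtain ⟨c, hc, hc'⟩ := exists_hasDerivAt_eq_zero hl
          (fun t _ => (hG 0 t).continuousAt.continuousWithinAt) (e1.trans e2.symm)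
          (fun t _ => hG 0 t)
        exact ⟨c, fun _ => Or.inr ⟨hc.1, hc.2, hc'⟩⟩
    · exact ⟨0, fun h => absurd h hi⟩
  choose y hy using key
  have hyl : ∀ i, i < m+1 → x i ≤ y i := by
    intro i hi
    rcases hy i hi with h | h
    · exact h.2.ge
    · exact h.1.le
  have hyr : ∀ i, i < m+1 → y i ≤ x (i+1) := by
    intro i hi
    rcases hy i hi with h | h
    · exact (h.2.trans h.1).le
    · exact h.2.1.le
  refine ⟨y, ⟨?_, ?_⟩, hyl 0 (by omega), hyr m (by omega)⟩
  · intro i j hij hj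
    rcases hij.eq_or_lt with rfl | hlt
    · exact le_rfl
    · exact (hyr i (by omega)).trans ((h1 (i+1) j hlt (by omega)).trans (hyl j hj))
  · intro i j hij hj he
    rcases hij.eq_or_lt with rfl | hlt
    · rcases hy i hj with h | h
      · have := h2 i (i+1) (by omega) (by omega) h.1
        simpa [h.2] using this
      · simpa using h.2.2
    · have a1 := hyr i (by omega)
      have a2 := h1 (i+1) j hlt (by omega)
      have a3 := hyl j hj
      rcases hy i (by omega) with h | h
      · rcases hy j hj with h' | h'
        · have := h2 i (j+1) (by omega) (by omega) (by rw [← h'.1, ← h'.2, ← he, h.2])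
          rw [← h.2] at this
          have e : j + 1 - i = j - i + 1 := by omega
          rwa [e] at this
        · linarith
      · linarith

lemma nodeV_zero (m : ℕ) : ∀ (G : ℕ → ℝ → ℝ) (_ : ∀ j x, HasDerivAt (G j) (G (j+1) x) x)
    (x : ℕ → ℝ) (_ : NodeV G (m+1) x), ∃ y, x 0 ≤ y ∧ y ≤ x m ∧ G m y = 0 := by
  induction m with
  | zero =>
    intro G hG x h
    exact ⟨x 0, le_rfl, le_rfl, by simpa using h.2 0 0 le_rfl (by omega) rfl⟩
  | succ m ih =>
    intro G hG x h
    obtain ⟨y, hy, h0, h1⟩ := nodeV_rolle G hG m x h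
    obtain ⟨z, hz0, hz1, hz⟩ := ih _ (fun j x => hG (j+1) x) y hy
    exact ⟨z, h0.trans hz0, hz1.trans h1, hz⟩

lemma nodeV_shift (G : ℕ → ℝ → ℝ) (N : ℕ) (x : ℕ → ℝ) (h : NodeV G N x) (i j : ℕ)
    (hij : i ≤ j) (hj : j < N) : NodeV G (j - i + 1) (fun k => x (i + k)) := by
  refine ⟨fun k l hkl hl => h.1 _ _ (by omega) (by omega), fun k l hkl hl he => ?_⟩
  have := h.2 (i+k) (i+l) (by omega) (by omega) he
  rwa [Nat.add_sub_add_left] at this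

/-- from node sequences to multiplicities -/
lemma not_vanish_of_node (F : ℝ → ℝ) (n : ℕ) (J : Set ℝ) (x : ℕ → ℝ)
    (h : NodeV (fun j => iteratedDeriv j F) (n+1) x) (hx : ∀ i, i < n+1 → x i ∈ J) :
    ¬ VanishAtMost F (n+1) n J := by
  intro hV
  classical
  let V := (Finset.range (n+1)).image x
  let fib : ℝ → Finset ℕ := fun v => (Finset.range (n+1)).filter (fun i => x i = v)
  have hmem : ∀ l : Fin V.card, ∃ i, i < n+1 ∧ x i = (V.equivFin.symm l : ℝ) := by
    intro l
    have := (V.equivFin.symm l).2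
    obtain ⟨i, hi, he⟩ := Finset.mem_image.mp this
    exact ⟨i, Finset.mem_range.mp hi, he⟩
  have := hV V.card (fun l => (V.equivFin.symm l : ℝ)) (fun l => (fib (V.equivFin.symm l)).card)
    ?_ ?_ ?_ ?_ ?_
  · have e : ∑ l : Fin V.card, (fib (V.equivFin.symm l)).card = n + 1 := by
      rw [Equiv.sum_comp V.equivFin.symm (fun v : V => (fib v).card),
        Finset.sum_coe_sort V (fun v => (fib v).card)]
      rw [← Finset.card_eq_sum_card_fiberwise (f := x) (s := Finset.range (n+1)) (t := V)]
      · simp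
      · intro i hi
        exact Finset.mem_image_of_mem _ hi
    omega
  · intro l
    obtain ⟨i, hi, he⟩ := hmem l
    exact he ▸ hx i hi
  · exact Subtype.val_injective.comp V.equivFin.symm.injective
  · intro l
    obtain ⟨i, hi, he⟩ := hmem l
    exact Finset.card_pos.mpr ⟨i, by simp [fib, hi, he]⟩
  · intro l
    exact (Finset.card_filter_le _ _).trans (by simp)
  · intro l j hj
    generalize (V.equivFin.symm l : ℝ) = v at hj
    have hne : (fib v).Nonempty := Finset.card_pos.mp (by omega)
    have m0 := (fib v).min'_mem hne
    have m1 := (fib v).max'_mem hne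
    have hsub : fib v ⊆ Finset.Icc ((fib v).min' hne) ((fib v).max' hne) := by
      intro i hi
      exact Finset.mem_Icc.mpr ⟨Finset.min'_le _ _ hi, Finset.le_max' _ _ hi⟩
    have hc := Finset.card_le_card hsub
    rw [Nat.card_Icc] at hc
    generalize (fib v).min' hne = p at *
    generalize (fib v).max' hne = q at *
    simp only [fib, Finset.mem_filter, Finset.mem_range] at m0 m1
    have hj2 : p + j ≤ q := by
      change j < (fib v).card at hj
      omega
    have e : x p = x (p+j) := by
      apply le_antisymm (h.1 _ _ (by omega) (by omega))
      rw [m0.2, ← m1.2]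
      exact h.1 _ _ hj2 m1.1
    have := h.2 p (p+j) (by omega) (by omega) e
    simpa [m0.2] using this

lemma node_of_not_vanish (F : ℝ → ℝ) (n : ℕ) (J : Set ℝ) (hV : ¬ VanishAtMost F (n+1) n J) :
    ∃ x : ℕ → ℝ, NodeV (fun j => iteratedDeriv j F) (n+1) x ∧ ∀ i, x i ∈ J := by
  classical
  unfold VanishAtMost at hV
  push Not at hV
  obtain ⟨r, xs, m, hJ, hinj, -, -, hv, hs⟩ := hV
  let T := Σ i : Fin r, Fin (m i)
  have hT : Fintype.card T = ∑ i, m i := by simp [T]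
  obtain ⟨N, hN⟩ : ∃ N, ∑ i, m i = N := ⟨_, rfl⟩
  let e : Fin N ≃ T := (Fintype.equivFinOfCardEq (hT.trans hN)).symm
  let g0 : Fin N → ℝ := fun k => xs (e k).1
  let σ := Tuple.sort g0
  let g : Fin N → ℝ := g0 ∘ σ
  have hg : Monotone g := Tuple.monotone_sort g0
  have hNn : n < N := by omega
  refine ⟨fun i => g ⟨min i n, by omega⟩, ⟨?_, ?_⟩, fun i => hJ _⟩
  · intro i j hij hj
    exact hg (by simp only [Fin.mk_le_mk]; omega)
  · intro i j hij hj he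
    have hi' : min i n = i := by omega
    have hj' : min j n = j := by omega
    simp only [hi', hj'] at he ⊢
    refine hv (e (σ ⟨i, by omega⟩)).1 (j - i) ?_
    set l := (e (σ ⟨i, by omega⟩)).1 with hl
    have hcard : (Finset.Icc (⟨i, by omega⟩ : Fin N) ⟨j, by omega⟩).card ≤
        ((Finset.univ : Finset (Fin (m l))).map ⟨fun b => (⟨l, b⟩ : T),
          fun a b h => eq_of_heq (Sigma.mk.inj h).2⟩).card := by
      apply Finset.card_le_card_of_injOn (fun k => e (σ k))
      · intro k hk
        have hk := Finset.mem_Icc.mp (Finset.mem_coe.mp hk)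
        have h1 := hg hk.1
        have h2 := hg hk.2
        have h3 : g k = g ⟨i, by omega⟩ := le_antisymm (h2.trans he.ge) h1
        have h4 : (e (σ k)).1 = l := hinj h3
        simp only [Finset.coe_map, Set.mem_image, Function.Embedding.coeFn_mk, Finset.coe_univ, Set.mem_univ, true_and]
        refine ⟨h4 ▸ (e (σ k)).2, ?_⟩
        generalize e (σ k) = t at h4
        obtain ⟨t1, t2⟩ := t
        simp only at h4
        subst h4
        rfl
      · intro a _ b _ hab
        exact σ.injective (e.injective hab)
    rw [Fin.card_Icc] at hcard
    simp at hcard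
    omega

lemma family_iteratedDeriv (G : ℕ → ℝ → ℝ) (hG : ∀ j x, HasDerivAt (G j) (G (j+1) x) x) (j : ℕ) :
    iteratedDeriv j (G 0) = G j := by
  induction j with
  | zero => simp
  | succ j ih =>
    rw [iteratedDeriv_succ, ih]
    funext x
    exact (hG j x).deriv

lemma family_contDiff (G : ℕ → ℝ → ℝ) (hG : ∀ j x, HasDerivAt (G j) (G (j+1) x) x) :
    ContDiff ℝ (⊤ : ℕ∞) (G 0) := by
  apply contDiff_of_differentiable_iteratedDeriv
  intro m _
  rw [family_iteratedDeriv G hG]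
  exact fun x => (hG m x).differentiableAt

/-- companion operator -/
def compL (n : ℕ) (a : Fin (n + 1) → ℝ) : (Fin (n+1) → ℝ) →L[ℝ] (Fin (n+1) → ℝ) :=
  LinearMap.toContinuousLinearMap
    { toFun := fun w i => if h : (i : ℕ) + 1 < n + 1 then w ⟨i + 1, h⟩ else - ∑ k, a k * w k
      map_add' := by
        intro v w
        funext i
        simp only [Pi.add_apply]
        split_ifs
        · rfl
        · rw [← neg_add, ← Finset.sum_add_distrib]
          congr 1
          exact Finset.sum_congr rfl fun k _ => by ring
      map_smul' := by
        intro c w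
        funext i
        simp only [Pi.smul_apply, smul_eq_mul, RingHom.id_apply]
        split_ifs
        · rfl
        · rw [mul_neg, Finset.mul_sum]
          congr 1
          exact Finset.sum_congr rfl fun k _ => by ring }

lemma compL_apply (n : ℕ) (a : Fin (n + 1) → ℝ) (w : Fin (n+1) → ℝ) (i : Fin (n+1)) :
    compL n a w i = if h : (i : ℕ) + 1 < n + 1 then w ⟨i + 1, h⟩ else - ∑ k, a k * w k := rfl

lemma compL_pow (n : ℕ) (a : Fin (n + 1) → ℝ) : ∀ (j : ℕ) (hj : j < n+1) (w : Fin (n+1) → ℝ),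
    ((compL n a)^j) w 0 = w ⟨j, hj⟩ := by
  intro j
  induction j with
  | zero => intro hj w; rfl
  | succ j ih =>
    intro hj w
    rw [pow_succ]
    change ((compL n a)^j) (compL n a w) 0 = _
    rw [ih (by omega), compL_apply, dif_pos hj]

lemma compL_pow_top (n : ℕ) (a : Fin (n + 1) → ℝ) (w : Fin (n+1) → ℝ) :
    ((compL n a)^(n+1)) w 0 = - ∑ k, a k * w k := by
  rw [pow_succ]
  change ((compL n a)^n) (compL n a w) 0 = _
  rw [compL_pow n a n (by omega), compL_apply,
    dif_neg (by simp)]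

def flowL (n : ℕ) (a : Fin (n + 1) → ℝ) (v : Fin (n+1) → ℝ) (x : ℝ) : Fin (n+1) → ℝ :=
  NormedSpace.exp (x • compL n a) v

lemma flowL_deriv (n : ℕ) (a : Fin (n + 1) → ℝ) (v : Fin (n+1) → ℝ) (x : ℝ) :
    HasDerivAt (flowL n a v) (compL n a (flowL n a v x)) x := by
  have := hasDerivAt_exp_smul_const' (compL n a) x
  exact (ContinuousLinearMap.apply ℝ (Fin (n+1) → ℝ) v).hasFDerivAt.comp_hasDerivAt x this

def solG (n : ℕ) (a : Fin (n + 1) → ℝ) (v : Fin (n+1) → ℝ) (j : ℕ) (x : ℝ) : ℝ :=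
  ((compL n a)^j) (flowL n a v x) 0

lemma solG_deriv (n : ℕ) (a : Fin (n + 1) → ℝ) (v : Fin (n+1) → ℝ) (j : ℕ) (x : ℝ) :
    HasDerivAt (solG n a v j) (solG n a v (j+1) x) x := by
  have h := ((compL n a)^j).hasFDerivAt.comp_hasDerivAt x (flowL_deriv n a v x)
  have := (hasDerivAt_pi.mp h) 0
  have e : solG n a v (j+1) x = ((compL n a)^j) (compL n a (flowL n a v x)) 0 := by
    rw [solG, pow_succ]
    rfl
  rw [e]
  exact this

lemma solG_zero (n : ℕ) (a : Fin (n + 1) → ℝ) (v : Fin (n+1) → ℝ) (j : ℕ) (hj : j < n+1) :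
    solG n a v j 0 = v ⟨j, hj⟩ := by
  rw [solG, compL_pow n a j hj]
  simp [flowL]

lemma solG_smul (n : ℕ) (a : Fin (n + 1) → ℝ) (c : ℝ) (v : Fin (n+1) → ℝ) (j : ℕ) (x : ℝ) :
    solG n a (c • v) j x = c * solG n a v j x := by
  simp [solG, flowL]

lemma solG_continuous (n : ℕ) (a : Fin (n + 1) → ℝ) (j : ℕ) :
    Continuous (fun p : (Fin (n+1) → ℝ) × ℝ => solG n a p.1 j p.2) := by
  have h1 : Continuous (fun p : (Fin (n+1) → ℝ) × ℝ => NormedSpace.exp (p.2 • compL n a)) :=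
    (differentiable_exp_smul_const ℝ (compL n a)).continuous.comp continuous_snd
  have h2 : Continuous (fun p : (Fin (n+1) → ℝ) × ℝ => flowL n a p.1 p.2) :=
    h1.clm_apply continuous_fst
  exact (continuous_apply 0).comp (((compL n a)^j).continuous.comp h2)

lemma solG_mem (n : ℕ) (a : Fin (n + 1) → ℝ) (v : Fin (n+1) → ℝ) :
    solG n a v 0 ∈ kerOp n a := by
  refine ⟨family_contDiff _ (solG_deriv n a v), fun x => ?_⟩
  simp only [family_iteratedDeriv _ (solG_deriv n a v)]
  have : ∀ i : Fin (n+1), solG n a v i x = flowL n a v x i :=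
    fun i => compL_pow n a i i.2 _
  simp only [this]
  rw [solG, compL_pow_top]
  ring

lemma ker_eq_solG (n : ℕ) (a : Fin (n + 1) → ℝ) (F : ℝ → ℝ) (hF : F ∈ kerOp n a) :
    ∃ v, F = solG n a v 0 := by
  obtain ⟨hc, he⟩ := hF
  have hd : ∀ (j : ℕ) (x : ℝ), HasDerivAt (iteratedDeriv j F) (iteratedDeriv (j+1) F x) x := by
    intro j x
    rw [iteratedDeriv_succ]
    exact ((hc.differentiable_iteratedDeriv j (by exact_mod_cast WithTop.coe_lt_top j)) x).hasDerivAt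
  let Y : ℝ → Fin (n+1) → ℝ := fun x i => iteratedDeriv i F x
  have hY : ∀ x, HasDerivAt Y (compL n a (Y x)) x := by
    intro x
    rw [hasDerivAt_pi]
    intro i
    have := hd i x
    rw [compL_apply]
    split_ifs with h
    · exact this
    · have hi : (i : ℕ) = n := by have := i.2; omega
      have e := he x
      have e2 : - ∑ k, a k * Y x k = iteratedDeriv ((i : ℕ)+1) F x := by
        rw [hi]; simp only [Y]; linarith
      rw [e2]; exact this
  have key : Y = flowL n a (Y 0) := by
    refine ODE_solution_unique_univ (v := fun _ => compL n a) (s := fun _ => Set.univ) (t₀ := 0)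
      (K := ‖compL n a‖₊) (fun t => (compL n a).lipschitz.lipschitzOnWith)
      (fun t => ⟨hY t, trivial⟩) (fun t => ⟨flowL_deriv n a _ t, trivial⟩) ?_
    simp [flowL]
  refine ⟨Y 0, ?_⟩
  funext x
  have := congrFun (congrFun key x) 0
  simpa [Y, solG] using this

lemma nonreal_zeros (n : ℕ) (a : Fin (n + 1) → ℝ)
    (hnonreal : ∃ z : ℂ,
      z ^ (n + 1) + ∑ i : Fin (n + 1), (a i : ℂ) * z ^ (i : ℕ) = 0 ∧ z.im ≠ 0) :
    ∃ H : ℝ, ∃ F ∈ kerOp n a, F ≠ 0 ∧ ¬ VanishAtMost F (n + 1) n (Set.Icc 0 H) := by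
  obtain ⟨z, hz, him⟩ := hnonreal
  let G : ℕ → ℝ → ℝ := fun j x => (z^j * Complex.exp (z * x)).im
  have hG : ∀ j x, HasDerivAt (G j) (G (j+1) x) x := by
    intro j x
    have h1 : HasDerivAt (fun x : ℝ => z * (x : ℂ)) z x := by
      simpa using (Complex.ofRealCLM.hasDerivAt (x := x)).const_mul z
    have h2 := (h1.cexp.const_mul (z^j))
    have h3 := Complex.imCLM.hasFDerivAt.comp_hasDerivAt x h2
    convert! h3 using 1
    simp only [G, Complex.imCLM_apply]
    congr 1
    ring
  have hG0 : ∀ x, G 0 x = Real.exp (z.re * x) * Real.sin (z.im * x) := by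
    intro x
    simp [G, Complex.exp_im]
  have hpos : 0 < |z.im| := abs_pos.mpr him
  refine ⟨n * (Real.pi / |z.im|), G 0, ⟨family_contDiff G hG, ?_⟩, ?_, ?_⟩
  · intro x
    simp only [family_iteratedDeriv G hG]
    have := congrArg (fun w => (w * Complex.exp (z * x)).im) hz
    simp only [add_mul, Finset.sum_mul, Complex.add_im, Complex.im_sum, zero_mul, Complex.zero_im] at this
    rw [← this]
    congr 1
    refine Finset.sum_congr rfl fun i _ => ?_
    rw [mul_assoc, Complex.im_ofReal_mul]
  · intro h
    have := congrFun h (Real.pi / 2 / z.im)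
    rw [hG0] at this
    rw [mul_div_cancel₀ _ him] at this
    simp [Real.exp_ne_zero] at this
  · intro hV
    have := hV (n+1) (fun i => (i : ℕ) * (Real.pi / |z.im|)) (fun _ => 1) ?_ ?_ ?_ ?_ ?_
    · simp at this
    · intro i
      refine ⟨by positivity, ?_⟩
      have : ((i : ℕ) : ℝ) ≤ n := by exact_mod_cast Nat.lt_succ_iff.mp i.2
      gcongr
    · intro i j hij
      have hp : Real.pi / |z.im| ≠ 0 := by positivity
      have := mul_right_cancel₀ hp hij
      exact Fin.ext (by exact_mod_cast this)
    · simp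
    · simp
    · intro i j hj
      obtain rfl : j = 0 := by omega
      simp only [iteratedDeriv_zero]
      rw [hG0]
      have : Real.sin (z.im * ((i : ℕ) * (Real.pi / |z.im|))) = 0 := by
        rcases abs_cases z.im with ⟨h, _⟩ | ⟨h, _⟩
        · rw [h, show z.im * ((i : ℕ) * (Real.pi / z.im)) = (i : ℕ) * Real.pi by field_simp]
          exact Real.sin_nat_mul_pi _
        · rw [h, show z.im * ((i : ℕ) * (Real.pi / -z.im)) = -((i : ℕ) * Real.pi) by field_simp]
          rw [Real.sin_neg, Real.sin_nat_mul_pi, neg_zero]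
      rw [this, mul_zero]

def badK (n : ℕ) (a : Fin (n + 1) → ℝ) (H : ℝ) : Set ((Fin (n+1) → ℝ) × (ℕ → ℝ)) :=
  {p | p.1 ∈ Metric.sphere 0 1 ∧ p.2 ∈ Set.pi Set.univ (fun _ => Set.Icc 0 H) ∧
    NodeV (solG n a p.1) (n+1) p.2}

lemma badK_closed (n : ℕ) (a : Fin (n + 1) → ℝ) :
    IsClosed {p : (Fin (n+1) → ℝ) × (ℕ → ℝ) | NodeV (solG n a p.1) (n+1) p.2} := by
  apply IsSeqClosed.isClosed
  intro u p hu hup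
  have hv : Filter.Tendsto (fun k => (u k).1) Filter.atTop (nhds p.1) :=
    (continuous_fst.tendsto p).comp hup
  have hx : ∀ i, Filter.Tendsto (fun k => (u k).2 i) Filter.atTop (nhds (p.2 i)) := fun i =>
    (((continuous_apply i).comp continuous_snd).tendsto p).comp hup
  refine ⟨fun i j hij hj => le_of_tendsto_of_tendsto' (hx i) (hx j) fun k => (hu k).1 i j hij hj, ?_⟩
  intro i j hij hj he
  have : ∀ k, ∃ y, (u k).2 i ≤ y ∧ y ≤ (u k).2 j ∧ solG n a (u k).1 (j - i) y = 0 := by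
    intro k
    have := nodeV_zero (j - i) _ (solG_deriv n a (u k).1) _ (nodeV_shift _ _ _ (hu k) i j hij hj)
    simpa [Nat.add_sub_cancel' hij] using this
  choose y hy1 hy2 hy3 using this
  have hy : Filter.Tendsto y Filter.atTop (nhds (p.2 i)) :=
    tendsto_of_tendsto_of_tendsto_of_le_of_le (hx i) (he ▸ hx j) hy1 hy2
  have ht := ((solG_continuous n a (j - i)).tendsto (p.1, p.2 i)).comp (hv.prodMk_nhds hy)
  have h0 : (fun p : (Fin (n+1) → ℝ) × ℝ => solG n a p.1 (j - i) p.2) ∘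
      (fun k => ((u k).1, y k)) = fun _ => 0 := funext hy3
  rw [h0] at ht
  exact tendsto_nhds_unique ht tendsto_const_nhds

lemma badK_compact (n : ℕ) (a : Fin (n + 1) → ℝ) (H : ℝ) : IsCompact (badK n a H) := by
  have h1 : IsCompact ((Metric.sphere (0 : Fin (n+1) → ℝ) 1) ×ˢ
      (Set.pi Set.univ (fun _ : ℕ => Set.Icc (0:ℝ) H))) :=
    (isCompact_sphere 0 1).prod (isCompact_univ_pi fun _ => isCompact_Icc)
  have := h1.inter_right (badK_closed n a)
  convert! this using 1
  ext p
  simp [badK, and_assoc]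

lemma badK_of_not_vanish (n : ℕ) (a : Fin (n + 1) → ℝ) (h : ℝ) (F : ℝ → ℝ) (hF : F ∈ kerOp n a)
    (hF0 : F ≠ 0) (hV : ¬ VanishAtMost F (n + 1) n (Set.Icc 0 h)) : (badK n a h).Nonempty := by
  obtain ⟨x, hx, hxm⟩ := node_of_not_vanish F n _ hV
  obtain ⟨v, rfl⟩ := ker_eq_solG n a F hF
  have hv : v ≠ 0 := by
    rintro rfl
    apply hF0
    funext x
    simp [solG, flowL]
  refine ⟨(‖v‖⁻¹ • v, x), ?_, fun i _ => hxm i, hx.1, ?_⟩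
  · simp [norm_smul, hv]
  · intro i j hij hj he
    have := hx.2 i j hij hj he
    simp only [family_iteratedDeriv _ (solG_deriv n a v)] at this
    rw [solG_smul, this, mul_zero]

theorem stmt2 (n : ℕ) (a : Fin (n + 1) → ℝ)
    (hnonreal : ∃ z : ℂ,
      z ^ (n + 1) + ∑ i : Fin (n + 1), (a i : ℂ) * z ^ (i : ℕ) = 0 ∧ z.im ≠ 0) :
    ∃ ℓ : ℝ, 0 < ℓ ∧ critLen n a = (ℓ : EReal) ∧
      ¬ IsECOn n a (Set.Icc 0 ℓ) ∧
      ∃ F ∈ kerOp n a, F ≠ 0 ∧ ¬ VanishAtMost F (n + 1) n (Set.Icc 0 ℓ) := by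
  obtain ⟨H, F0, hF0, hF0', hV0⟩ := nonreal_zeros n a hnonreal
  have hne := badK_of_not_vanish n a H F0 hF0 hF0' hV0
  have hcont : Continuous (fun p : (Fin (n+1) → ℝ) × (ℕ → ℝ) => p.2 n) := by fun_prop
  obtain ⟨⟨v, x⟩, ⟨hv, hxH, hnode⟩, hmin⟩ := (badK_compact n a H).exists_isMinOn hne hcont.continuousOn
  simp only at hv hxH hnode
  have hv0 : v ≠ 0 := by
    rintro rfl
    simp at hv
  have hle : ∀ i, i < n + 1 → x i ∈ Set.Icc 0 (x n) := fun i hi =>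
    ⟨(hxH i trivial).1, hnode.1 i n (by omega) (by omega)⟩
  have hpos : 0 < x n := by
    rcases (hxH n trivial).1.eq_or_lt with h | h
    · exfalso
      apply hv0
      have hz : ∀ i, i < n + 1 → x i = 0 := fun i hi => by
        have := hle i hi
        rw [← h] at this
        exact le_antisymm this.2 this.1
      funext i
      have := hnode.2 0 i (by omega) i.2 (by rw [hz 0 (by omega), hz i i.2])
      rw [hz 0 (by omega), Nat.sub_zero, solG_zero n a v i i.2] at this
      exact this
    · exact h
  have hS0 : solG n a v 0 ≠ 0 := by
    intro h
    apply hv0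
    funext i
    have h1 := family_iteratedDeriv _ (solG_deriv n a v) i
    rw [← solG_zero n a v i i.2, ← h1, h]
    simp
  have hbad : ∀ h, x n ≤ h → ¬ VanishAtMost (solG n a v 0) (n+1) n (Set.Icc 0 h) := by
    intro h hh
    apply not_vanish_of_node _ n _ x
    · simp only [family_iteratedDeriv _ (solG_deriv n a v)]
      exact hnode
    · intro i hi
      exact ⟨(hle i hi).1, (hle i hi).2.trans hh⟩
  have hgood : ∀ h, h < x n → IsECOn n a (Set.Icc 0 h) := by
    intro h hh F hF hF0
    by_contra hV
    obtain ⟨⟨w, y⟩, hw, hy, hN⟩ := badK_of_not_vanish n a h F hF hF0 hV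
    have hhH : h ≤ H := hh.le.trans (hxH n trivial).2
    have hm : (w, y) ∈ badK n a H :=
      ⟨hw, fun i _ => ⟨(hy i trivial).1, (hy i trivial).2.trans hhH⟩, hN⟩
    have h1 : x n ≤ y n := hmin hm
    have h2 : y n ≤ h := (hy n trivial).2
    linarith
  refine ⟨x n, hpos, ?_, fun h => hbad _ le_rfl (h _ (solG_mem n a v) hS0),
    solG n a v 0, solG_mem n a v, hS0, hbad _ le_rfl⟩
  apply le_antisymm
  · apply sSup_le
    rintro l ⟨h, rfl, -, hE⟩
    by_contra hlt
    have hlt : x n < h := by exact_mod_cast not_le.mp hlt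
    exact hbad h hlt.le (hE _ (solG_mem n a v) hS0)
  · by_contra hlt
    obtain ⟨r, hr1, hr2⟩ := EReal.lt_iff_exists_real_btwn.mp (not_le.mp hlt)
    have hr2 : r < x n := by exact_mod_cast hr2
    have h1 : ((max r (x n / 2) : ℝ) : EReal) ≤ critLen n a :=
      le_sSup ⟨_, rfl, lt_max_of_lt_right (by linarith), hgood _ (max_lt hr2 (by linarith))⟩
    have h2 : (r : EReal) ≤ ((max r (x n / 2) : ℝ) : EReal) := by
      exact_mod_cast le_max_left _ _
    exact absurd (h2.trans h1) (not_le.mpr hr1)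
end
end

section
/- Let L = D^{n+1} + Σ_{i=0}^n a_i D^i (n ≥ 1) have characteristic polynomial p_L with at least one nonreal root. Let S be the unique element of E_L with S(0) = S'(0) = ⋯ = S^{(n−1)}(0) = 0 and S^{(n)}(0) = 1, and for 0 ≤ k ≤ n−1 let W_k(h) := det((S^{(i+j)}(h))_{0 ≤ i,j ≤ k}) be the Wronskian of (S, S', …, S^{(k)}) at h. Then the critical length satisfies ℓ_L = min_{0 ≤ k ≤ n−1} inf{h > 0 : W_k(h) = 0}, with the convention inf ∅ = +∞. -/
open scoped BigOperators

noncomputable section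

/-- The Wronskian of `(S, S', …, S^(k))` at `h`, i.e. `det ((S^(i+j)(h))_{0 ≤ i,j ≤ k})`. -/
def WronS (S : ℝ → ℝ) (k : ℕ) (h : ℝ) : ℝ :=
  (Matrix.of fun i j : Fin (k + 1) => iteratedDeriv ((i : ℕ) + (j : ℕ)) S h).det


theorem van_congr {F G : ℝ → ℝ} {m : ℕ} {x : ℝ} (h : F =ᶠ[nhds x] G)
    (hF : VanishAtLeast F m x) : VanishAtLeast G m x := fun j hj => by
  rw [← h.iteratedDeriv_eq]; exact hF j hj

theorem van_mono {F : ℝ → ℝ} {m k : ℕ} {x : ℝ} (h : k ≤ m)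
    (hF : VanishAtLeast F m x) : VanishAtLeast F k x := fun j hj => hF j (by omega)

theorem van_deriv {F : ℝ → ℝ} {m : ℕ} {x : ℝ}
    (hF : VanishAtLeast F m x) : VanishAtLeast (deriv F) (m - 1) x := fun j hj => by
  rw [← iteratedDeriv_succ']; exact hF _ (by omega)

theorem van_succ {F : ℝ → ℝ} {m : ℕ} {x : ℝ} (h0 : F x = 0)
    (hF : VanishAtLeast (deriv F) m x) : VanishAtLeast F (m + 1) x := fun j hj => by
  cases j with
  | zero => simpa using h0
  | succ j => rw [iteratedDeriv_succ']; exact hF _ (by omega)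

theorem van_mul {F g : ℝ → ℝ} {m : ℕ} {x : ℝ} (hg : ContDiffAt ℝ (⊤ : ℕ∞) g x)
    (hF' : ContDiffAt ℝ (⊤ : ℕ∞) F x)
    (hF : VanishAtLeast F m x) : VanishAtLeast (fun y => F y * g y) m x := fun j hj => by
  have := iteratedDeriv_mul (contDiffAt_infty.1 hF' j) (contDiffAt_infty.1 hg j)
  change iteratedDeriv j (F * g) x = 0
  rw [this]
  apply Finset.sum_eq_zero
  intro i hi
  rw [hF i (by simp at hi; omega)]; simp

/-- Rolle points. -/
theorem rolle_pts (I : Set ℝ) (hc : I.OrdConnected) (G : ℝ → ℝ) (hG : ∀ x ∈ I, ContinuousAt G x)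
    (s : Finset ℝ) : (∀ x ∈ s, x ∈ I ∧ G x = 0) →
    ∃ T : Finset ℝ, (∀ t ∈ T, t ∈ I ∧ deriv G t = 0 ∧ t ∉ s ∧ ∃ x ∈ s, t < x) ∧
      s.card ≤ T.card + 1 := by
  induction s using Finset.induction_on_max with
  | empty => intro _; exact ⟨∅, by simp, by simp⟩
  | insert a s hlt ih =>
    intro hs
    have ha : a ∉ s := fun h => lt_irrefl _ (hlt a h)
    obtain ⟨T, hT, hcard⟩ := ih (fun x hx => hs x (Finset.mem_insert_of_mem hx))
    rcases s.eq_empty_or_nonempty with rfl | hne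
    · exact ⟨∅, by simp, by simp⟩
    set b := s.max' hne with hb
    have hbs : b ∈ s := s.max'_mem hne
    have hba := hlt b hbs
    have hbI := hs b (Finset.mem_insert_of_mem hbs)
    have haI := hs a (Finset.mem_insert_self _ _)
    have hsub := hc.out hbI.1 haI.1
    obtain ⟨t, ht, htd⟩ := exists_deriv_eq_zero hba
      (fun x hx => (hG x (hsub hx)).continuousWithinAt) (hbI.2.trans haI.2.symm)
    have hmax : ∀ x ∈ s, x ≤ b := fun x hx => s.le_max' x hx
    have htT : t ∉ T := fun h => by
      obtain ⟨-, -, -, x, hx, hx'⟩ := hT t h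
      linarith [hmax x hx, ht.1]
    refine ⟨insert t T, ?_, ?_⟩
    · intro t' ht'
      rcases Finset.mem_insert.1 ht' with rfl | h
      · refine ⟨hsub ⟨ht.1.le, ht.2.le⟩, htd, ?_, a, Finset.mem_insert_self _ _, ht.2⟩
        intro h
        rcases Finset.mem_insert.1 h with rfl | h
        · exact lt_irrefl _ ht.2
        · linarith [hmax _ h, ht.1]
      · obtain ⟨h1, h2, h3, x, hx, hx'⟩ := hT t' h
        refine ⟨h1, h2, ?_, x, Finset.mem_insert_of_mem hx, hx'⟩
        intro h
        rcases Finset.mem_insert.1 h with rfl | h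
        · linarith [hmax _ hx]
        · exact h3 h
    · rw [Finset.card_insert_of_notMem ha, Finset.card_insert_of_notMem htT]; omega

theorem rolle_mult (I : Set ℝ) (hc : I.OrdConnected) (G : ℝ → ℝ) (hG : ∀ x ∈ I, ContinuousAt G x)
    (s : Finset ℝ) (m : ℝ → ℕ) (hs : ∀ x ∈ s, x ∈ I) (hv : ∀ x ∈ s, VanishAtLeast G (m x) x) :
    ∃ (s' : Finset ℝ) (m' : ℝ → ℕ), (∀ x ∈ s', x ∈ I) ∧
      (∀ x ∈ s', VanishAtLeast (deriv G) (m' x) x) ∧ ∑ x ∈ s, m x ≤ ∑ x ∈ s', m' x + 1 := by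
  classical
  set s0 := s.filter (fun x => 1 ≤ m x) with hs0
  obtain ⟨T, hT, hcard⟩ := rolle_pts I hc G hG s0 (fun x hx => by
    rw [hs0, Finset.mem_filter] at hx
    exact ⟨hs x hx.1, by simpa using hv x hx.1 0 hx.2⟩)
  refine ⟨s0 ∪ T, fun x => if x ∈ s0 then m x - 1 else 1, ?_, ?_, ?_⟩
  · intro x hx
    rcases Finset.mem_union.1 hx with h | h
    · exact hs x (Finset.mem_filter.1 h).1
    · exact (hT x h).1
  · intro x hx
    by_cases h : x ∈ s0
    · simp only [h, if_true]
      exact van_deriv (hv x (Finset.mem_filter.1 h).1)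
    · simp only [h, if_false]
      have h' := (Finset.mem_union.1 hx).resolve_left h
      intro j hj
      obtain rfl : j = 0 := by omega
      simpa using (hT x h').2.1
  · have hd : Disjoint s0 T := by
      rw [Finset.disjoint_right]; intro x hx; exact (hT x hx).2.2.1
    rw [Finset.sum_union hd]
    have e1 : ∑ x ∈ s, m x = ∑ x ∈ s0, m x := by
      rw [hs0, Finset.sum_filter]
      apply Finset.sum_congr rfl
      intro x _
      split_ifs <;> omega
    have e2 : ∑ x ∈ s0, m x = ∑ x ∈ s0, (if x ∈ s0 then m x - 1 else 1) + s0.card := by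
      rw [Finset.card_eq_sum_ones, ← Finset.sum_add_distrib]
      apply Finset.sum_congr rfl
      intro x hx
      have := (Finset.mem_filter.1 hx).2
      simp only [hx, if_true]; omega
    have e3 : ∑ x ∈ T, (if x ∈ s0 then m x - 1 else 1) = T.card := by
      rw [Finset.card_eq_sum_ones]
      apply Finset.sum_congr rfl
      intro x hx
      simp [(hT x hx).2.2.1]
    omega

theorem exists_pos_mult {s : Finset ℝ} {m : ℝ → ℕ} {N : ℕ} (h : N + 1 ≤ ∑ x ∈ s, m x) :
    ∃ x ∈ s, 1 ≤ m x := by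
  by_contra hcon
  push Not at hcon
  have : ∑ x ∈ s, m x = 0 := Finset.sum_eq_zero fun x hx => by have := hcon x hx; omega
  omega

theorem polya (I : Set ℝ) (hI : IsOpen I) (hc : I.OrdConnected) : ∀ (n : ℕ) (u : ℕ → ℝ → ℝ),
    (∀ j, ∀ x ∈ I, ContDiffAt ℝ (⊤ : ℕ∞) (u j) x) →
    (∀ k ≤ n, ∀ x ∈ I, ∀ c : ℕ → ℝ,
      VanishAtLeast (fun y => ∑ j ∈ Finset.range (k + 1), c j * u j y) (k + 1) x →
        ∀ j ≤ k, c j = 0) →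
    ∀ (c : ℕ → ℝ) (s : Finset ℝ) (m : ℝ → ℕ), (∀ x ∈ s, x ∈ I) →
      (∀ x ∈ s, VanishAtLeast (fun y => ∑ j ∈ Finset.range (n + 1), c j * u j y) (m x) x) →
      n + 1 ≤ ∑ x ∈ s, m x → ∀ j ≤ n, c j = 0 := by
  intro n
  induction n with
  | zero =>
    intro u hu hW c s m hs hv hsum j hj
    obtain ⟨x, hx, hm⟩ := exists_pos_mult hsum
    exact hW 0 le_rfl x (hs x hx) c (van_mono hm (hv x hx)) j hj
  | succ n ih =>
    intro u hu hW c s m hs hv hsum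
    have hu0 : ∀ x ∈ I, u 0 x ≠ 0 := by
      intro x hx h0
      have := hW 0 (by omega) x hx (fun _ => 1) (by
        intro j hj
        obtain rfl : j = 0 := by omega
        simpa using h0) 0 le_rfl
      simp at this
    have hinv : ∀ x ∈ I, ContDiffAt ℝ (⊤ : ℕ∞) (fun y => (u 0 y)⁻¹) x := fun x hx =>
      (hu 0 x hx).inv (hu0 x hx)
    set q : ℕ → ℝ → ℝ := fun j y => u (j + 1) y * (u 0 y)⁻¹ with hq
    have hqs : ∀ j, ∀ x ∈ I, ContDiffAt ℝ (⊤ : ℕ∞) (q j) x := fun j x hx =>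
      (hu (j + 1) x hx).mul (hinv x hx)
    have hqd : ∀ j, ∀ x ∈ I, DifferentiableAt ℝ (q j) x := fun j x hx =>
      (hqs j x hx).differentiableAt (by simp)
    set v : ℕ → ℝ → ℝ := fun j => deriv (q j) with hvdef
    have hvs : ∀ j, ∀ x ∈ I, ContDiffAt ℝ (⊤ : ℕ∞) (v j) x := fun j x hx =>
      (hqs j x hx).derivWithin (by simp)
    -- derivative of a combination
    have hder : ∀ (k : ℕ) (b : ℝ) (d : ℕ → ℝ), ∀ x ∈ I,
        deriv (fun y => ∑ j ∈ Finset.range k, d j * q j y + b) x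
          = ∑ j ∈ Finset.range k, d j * v j x := by
      intro k b d x hx
      rw [deriv_add_const, deriv_fun_sum (fun j _ => (hqd j x hx).const_mul _)]
      exact Finset.sum_congr rfl fun j _ => deriv_const_mul _ (hqd j x hx)
    have key := ih v hvs (by
      intro k hk x hx d hd
      set b := -∑ j ∈ Finset.range (k + 1), d j * q j x with hb
      have h1 : VanishAtLeast (fun y => ∑ j ∈ Finset.range (k + 1), d j * q j y + b)
          (k + 1 + 1) x := by
        apply van_succ
        · simp [hb]
        · refine van_congr ?_ hd
          filter_upwards [hI.mem_nhds hx] with y hy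
          exact (hder _ _ _ y hy).symm
      have h2 := van_mul (hu 0 x hx) (by
        exact (ContDiffAt.sum fun j _ => contDiffAt_const.mul (hqs j x hx)).add contDiffAt_const) h1
      have h3 := hW (k + 1) (by omega) x hx (fun j => if j = 0 then b else d (j - 1)) (by
        refine van_congr ?_ h2
        filter_upwards [hI.mem_nhds hx] with y hy
        rw [Finset.sum_range_succ' _ (k + 1), add_mul, Finset.sum_mul]
        congr 1
        · apply Finset.sum_congr rfl
          intro j _
          have := hu0 y hy
          simp only [hq, Nat.add_one_ne_zero, if_false, Nat.add_sub_cancel]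
          field_simp)
      intro j hj
      simpa using h3 (j + 1) (by omega))
    obtain ⟨s', m', hs', hv', hsum'⟩ := rolle_mult I hc
      (fun y => ∑ j ∈ Finset.range (n + 1), c (j + 1) * q j y + c 0)
      (fun x hx => ((ContDiffAt.sum fun j _ => contDiffAt_const.mul (hqs j x hx)).add
        contDiffAt_const : ContDiffAt ℝ (⊤ : ℕ∞) _ x).continuousAt) s m hs (by
      intro x hx
      have h2 := van_mul (hinv x (hs x hx))
        (ContDiffAt.sum fun j _ => contDiffAt_const.mul (hu j x (hs x hx))) (hv x hx)
      refine van_congr ?_ h2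
      filter_upwards [hI.mem_nhds (hs x hx)] with y hy
      have := hu0 y hy
      rw [Finset.sum_range_succ' _ (n + 1), add_mul, Finset.sum_mul]
      congr 1
      · apply Finset.sum_congr rfl
        intro j _
        simp only [hq]; ring
      · field_simp)
    have hz := key (fun j => c (j + 1)) s' m' hs' (by
      intro x hx
      refine van_congr ?_ (hv' x hx)
      filter_upwards [hI.mem_nhds (hs' x hx)] with y hy
      exact hder _ _ _ y hy) (by omega)
    intro j hj
    cases j with
    | succ j => exact hz j (by omega)
    | zero =>
      obtain ⟨x, hx, hm⟩ := exists_pos_mult hsum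
      have h := hv x hx 0 (by omega)
      simp only [iteratedDeriv_zero] at h
      rw [Finset.sum_range_succ', Finset.sum_eq_zero (fun j hj => by
        rw [hz j (by simp at hj; omega), zero_mul])] at h
      simpa [hu0 x (hs x hx)] using h

theorem rolle_all (I : Set ℝ) (hc : I.OrdConnected) : ∀ (N : ℕ) (F : ℝ → ℝ),
    ContDiff ℝ (⊤ : ℕ∞) F → ∀ (s : Finset ℝ) (m : ℝ → ℕ), (∀ x ∈ s, x ∈ I) →
    (∀ x ∈ s, VanishAtLeast F (m x) x) → N + 1 ≤ ∑ x ∈ s, m x →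
    ∀ j ≤ N, ∃ x ∈ I, iteratedDeriv j F x = 0 := by
  intro N
  induction N with
  | zero =>
    intro F hF s m hs hv hsum j hj
    obtain rfl : j = 0 := by omega
    obtain ⟨x, hx, hm⟩ := exists_pos_mult hsum
    exact ⟨x, hs x hx, hv x hx 0 hm⟩
  | succ N ih =>
    intro F hF s m hs hv hsum j hj
    cases j with
    | zero =>
      obtain ⟨x, hx, hm⟩ := exists_pos_mult hsum
      exact ⟨x, hs x hx, hv x hx 0 hm⟩
    | succ j =>
      obtain ⟨s', m', hs', hv', hsum'⟩ := rolle_mult I hc F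
        (fun x _ => hF.continuous.continuousAt) s m hs hv
      rw [iteratedDeriv_succ']
      exact ih (deriv F) (contDiff_infty_iff_deriv.1 hF).2 s' m' hs' hv' (by omega) j (by omega)

theorem iter_add (i j : ℕ) (F : ℝ → ℝ) :
    iteratedDeriv i (iteratedDeriv j F) = iteratedDeriv (i + j) F := by
  simp only [iteratedDeriv_eq_iterate, Function.iterate_add_apply]

theorem smooth_iter {F : ℝ → ℝ} (hF : ContDiff ℝ (⊤ : ℕ∞) F) (j : ℕ) :
    ContDiff ℝ (⊤ : ℕ∞) (iteratedDeriv j F) := by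
  induction j with
  | zero => simpa using hF
  | succ j ih => rw [iteratedDeriv_succ]; exact (contDiff_infty_iff_deriv.1 ih).2

theorem iter_hasDerivAt {F : ℝ → ℝ} (hF : ContDiff ℝ (⊤ : ℕ∞) F) (j : ℕ) (x : ℝ) :
    HasDerivAt (iteratedDeriv j F) (iteratedDeriv (j + 1) F x) x := by
  rw [iteratedDeriv_succ]
  exact ((smooth_iter hF j).differentiable (by simp) x).hasDerivAt

theorem ker_deriv {n : ℕ} {a : Fin (n + 1) → ℝ} {F : ℝ → ℝ} (hF : F ∈ kerOp n a) :
    deriv F ∈ kerOp n a := by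
  refine ⟨(contDiff_infty_iff_deriv.1 hF.1).2, fun x => ?_⟩
  have h1 : HasDerivAt (fun x => iteratedDeriv (n + 1) F x
      + ∑ i : Fin (n + 1), a i * iteratedDeriv (i : ℕ) F x)
      (iteratedDeriv (n + 1 + 1) F x
      + ∑ i : Fin (n + 1), a i * iteratedDeriv ((i : ℕ) + 1) F x) x :=
    (iter_hasDerivAt hF.1 _ x).add
      (HasDerivAt.fun_sum fun i _ => (iter_hasDerivAt hF.1 _ x).const_mul _)
  have h2 : (fun x => iteratedDeriv (n + 1) F x
      + ∑ i : Fin (n + 1), a i * iteratedDeriv (i : ℕ) F x) = fun _ => 0 := funext hF.2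
  rw [h2] at h1
  have := h1.unique (hasDerivAt_const x (0 : ℝ))
  simpa only [iteratedDeriv_succ'] using this

theorem ker_iter {n : ℕ} {a : Fin (n + 1) → ℝ} {F : ℝ → ℝ} (hF : F ∈ kerOp n a) (j : ℕ) :
    iteratedDeriv j F ∈ kerOp n a := by
  induction j with
  | zero => simpa using hF
  | succ j ih => rw [iteratedDeriv_succ]; exact ker_deriv ih

/-- Linear combinations of derivatives. -/
def comb (S : ℝ → ℝ) (N : ℕ) (c : ℕ → ℝ) : ℝ → ℝ :=
  fun y => ∑ j ∈ Finset.range N, c j * iteratedDeriv j S y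

theorem comb_smooth {S : ℝ → ℝ} (hS : ContDiff ℝ (⊤ : ℕ∞) S) (N : ℕ) (c : ℕ → ℝ) :
    ContDiff ℝ (⊤ : ℕ∞) (comb S N c) :=
  ContDiff.sum fun j _ => contDiff_const.mul (smooth_iter hS j)

theorem comb_iter {S : ℝ → ℝ} (hS : ContDiff ℝ (⊤ : ℕ∞) S) (N : ℕ) (c : ℕ → ℝ) (i : ℕ) (x : ℝ) :
    iteratedDeriv i (comb S N c) x = ∑ j ∈ Finset.range N, c j * iteratedDeriv (i + j) S x := by
  unfold comb
  rw [iteratedDeriv_fun_sum (fun j _ =>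
    contDiffAt_infty.1 (contDiff_const.mul (smooth_iter hS j)).contDiffAt i)]
  apply Finset.sum_congr rfl
  intro j _
  rw [iteratedDeriv_const_mul_field, iter_add]

theorem comb_ker {n : ℕ} {a : Fin (n + 1) → ℝ} {S : ℝ → ℝ} (hS : S ∈ kerOp n a)
    (N : ℕ) (c : ℕ → ℝ) : comb S N c ∈ kerOp n a := by
  refine ⟨comb_smooth hS.1 N c, fun x => ?_⟩
  simp only [comb_iter hS.1, Finset.mul_sum]
  rw [Finset.sum_comm, ← Finset.sum_add_distrib]
  apply Finset.sum_eq_zero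
  intro j _
  have := (ker_iter hS j).2 x
  simp only [iter_add] at this
  calc _ = c j * (iteratedDeriv (n + 1 + j) S x
        + ∑ i : Fin (n + 1), a i * iteratedDeriv ((i : ℕ) + j) S x) := by
        rw [mul_add, Finset.mul_sum]; congr 1; apply Finset.sum_congr rfl; intros; ring
    _ = 0 := by rw [this, mul_zero]

theorem ker_sub {n : ℕ} {a : Fin (n + 1) → ℝ} {F G : ℝ → ℝ} (hF : F ∈ kerOp n a)
    (hG : G ∈ kerOp n a) : F - G ∈ kerOp n a ∧
      ∀ i x, iteratedDeriv i (F - G) x = iteratedDeriv i F x - iteratedDeriv i G x := by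
  have h : ∀ i x, iteratedDeriv i (F - G) x = iteratedDeriv i F x - iteratedDeriv i G x :=
    fun i x => iteratedDeriv_sub (contDiffAt_infty.1 hF.1.contDiffAt i)
      (contDiffAt_infty.1 hG.1.contDiffAt i)
  refine ⟨⟨hF.1.sub hG.1, fun x => ?_⟩, h⟩
  simp only [h, mul_sub, Finset.sum_sub_distrib]
  linarith [hF.2 x, hG.2 x]

/-- Uniqueness for the initial value problem. -/
theorem ker_unique {n : ℕ} {a : Fin (n + 1) → ℝ} {F : ℝ → ℝ} (hF : F ∈ kerOp n a)
    {x₀ : ℝ} (h0 : VanishAtLeast F (n + 1) x₀) : F = 0 := by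
  let A : (Fin (n + 1) → ℝ) →ₗ[ℝ] (Fin (n + 1) → ℝ) := LinearMap.pi fun i =>
    if h : (i : ℕ) + 1 < n + 1 then LinearMap.proj (⟨(i : ℕ) + 1, h⟩ : Fin (n + 1))
    else -∑ k : Fin (n + 1), a k • LinearMap.proj k
  let B := LinearMap.toContinuousLinearMap A
  have hAB : ∀ (t : ℝ), HasDerivAt (fun t => fun i : Fin (n + 1) => iteratedDeriv (i : ℕ) F t)
      (B (fun i : Fin (n + 1) => iteratedDeriv (i : ℕ) F t)) t := by
    intro t
    rw [hasDerivAt_pi]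
    intro i
    refine (iter_hasDerivAt hF.1 i t).congr_deriv ?_
    symm
    change A _ i = _
    by_cases h : (i : ℕ) + 1 < n + 1
    · simp only [A, LinearMap.pi_apply, h, dif_pos, LinearMap.proj_apply]
    · simp only [A, LinearMap.pi_apply, h, dif_neg, not_false_eq_true]
      have hi : (i : ℕ) = n := by omega
      rw [hi]
      simp only [LinearMap.neg_apply, LinearMap.sum_apply, LinearMap.smul_apply,
        LinearMap.proj_apply, smul_eq_mul]
      linarith [hF.2 t]
  have := ODE_solution_unique_univ (v := fun _ => B) (s := fun _ => Set.univ) (t₀ := x₀)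
    (f := fun t => fun i : Fin (n + 1) => iteratedDeriv (i : ℕ) F t) (g := fun _ => 0)
    (fun t => B.lipschitz.lipschitzOnWith) (fun t => ⟨hAB t, trivial⟩)
    (fun t => ⟨by simpa using hasDerivAt_const t (0 : Fin (n + 1) → ℝ), trivial⟩)
    (by funext i; exact h0 i i.2)
  funext t
  simpa using congrFun (congrFun this t) 0

theorem triangular {n : ℕ} {S : ℝ → ℝ} (hS0 : ∀ j < n, iteratedDeriv j S 0 = 0)
    (hSn : iteratedDeriv n S 0 = 1) (c : ℕ → ℝ)
    (h : ∀ i ≤ n, ∑ j ∈ Finset.range (n + 1), c j * iteratedDeriv (i + j) S 0 = 0) :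
    ∀ j ≤ n, c j = 0 := by
  have key : ∀ i, i ≤ n → c (n - i) = 0 := by
    intro i
    induction i using Nat.strong_induction_on with
    | _ i ih =>
      intro hi
      have h1 := h i hi
      rw [Finset.sum_eq_single (n - i)] at h1
      · rw [show i + (n - i) = n by omega, hSn, mul_one] at h1; exact h1
      · intro j hj hne
        have hj' : j ≤ n := by simp at hj; omega
        rcases lt_or_gt_of_ne hne with hlt | hgt
        · rw [hS0 _ (by omega), mul_zero]
        · have := ih (n - j) (by omega) (by omega)
          rw [show n - (n - j) = j by omega] at this
          rw [this, zero_mul]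
      · intro hh; simp at hh
  intro j hj
  have := key (n - j) (by omega)
  rwa [show n - (n - j) = j by omega] at this

/-- extension of a vector by zero -/
def ext0 (k : ℕ) (v : Fin (k + 1) → ℝ) : ℕ → ℝ := fun j => if h : j < k + 1 then v ⟨j, h⟩ else 0

theorem ext0_coe (k : ℕ) (v : Fin (k + 1) → ℝ) (j : Fin (k + 1)) : ext0 k v j = v j := by
  unfold ext0
  rw [dif_pos j.2]

theorem ext0_sum (k : ℕ) (v : Fin (k + 1) → ℝ) (g : ℕ → ℝ) :
    ∑ j ∈ Finset.range (k + 1), ext0 k v j * g j = ∑ j : Fin (k + 1), v j * g j := by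
  rw [Finset.sum_range]
  apply Finset.sum_congr rfl
  intro j _
  rw [ext0_coe]

theorem wron_mulVec (S : ℝ → ℝ) (k : ℕ) (x : ℝ) (v : Fin (k + 1) → ℝ) (i : Fin (k + 1)) :
    (Matrix.of fun i j : Fin (k + 1) => iteratedDeriv ((i : ℕ) + (j : ℕ)) S x).mulVec v i
      = ∑ j ∈ Finset.range (k + 1), ext0 k v j * iteratedDeriv ((i : ℕ) + j) S x := by
  rw [ext0_sum k v (fun j => iteratedDeriv ((i : ℕ) + j) S x)]
  simp only [Matrix.mulVec, dotProduct, Matrix.of_apply]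
  exact Finset.sum_congr rfl fun j _ => mul_comm _ _

theorem ker_span {n : ℕ} {a : Fin (n + 1) → ℝ} {S : ℝ → ℝ} (hS : S ∈ kerOp n a)
    (hS0 : ∀ j < n, iteratedDeriv j S 0 = 0) (hSn : iteratedDeriv n S 0 = 1)
    {F : ℝ → ℝ} (hF : F ∈ kerOp n a) : ∃ c, F = comb S (n + 1) c := by
  set M := (Matrix.of fun i j : Fin (n + 1) => iteratedDeriv ((i : ℕ) + (j : ℕ)) S 0) with hM
  have hdet : M.det ≠ 0 := by
    intro h
    obtain ⟨v, hv, hv0⟩ := Matrix.exists_mulVec_eq_zero_iff.2 h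
    apply hv
    have := triangular hS0 hSn (ext0 n v) (fun i hi => by
      have := congrFun hv0 ⟨i, by omega⟩
      rw [hM, wron_mulVec] at this
      exact this)
    funext j
    rw [← ext0_coe n v j]
    exact this j (by omega)
  obtain ⟨v, hv⟩ := (Matrix.mulVec_surjective_iff_isUnit.2
    ((Matrix.isUnit_iff_isUnit_det M).2 (isUnit_iff_ne_zero.2 hdet)))
      (fun i => iteratedDeriv (i : ℕ) F 0)
  refine ⟨ext0 n v, ?_⟩
  have hs := ker_sub hF (comb_ker hS (n + 1) (ext0 n v))
  have := ker_unique hs.1 (x₀ := 0) (fun i hi => by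
    rw [hs.2, comb_iter hS.1]
    have := congrFun hv ⟨i, hi⟩
    rw [hM, wron_mulVec] at this
    simp only at this
    rw [this, sub_self])
  exact sub_eq_zero.1 this

theorem ker_translate {n : ℕ} {a : Fin (n + 1) → ℝ} {F : ℝ → ℝ} (hF : F ∈ kerOp n a) (e : ℝ) :
    (fun y => F (y - e)) ∈ kerOp n a := by
  refine ⟨hF.1.comp (contDiff_id.sub contDiff_const), fun x => ?_⟩
  simp only [iteratedDeriv_comp_sub_const]
  exact hF.2 (x - e)

theorem EC_of_finset {n : ℕ} {a : Fin (n + 1) → ℝ} {J : Set ℝ}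
    (h : ∀ F ∈ kerOp n a, ∀ (s : Finset ℝ) (m : ℝ → ℕ), (∀ x ∈ s, x ∈ J) →
      (∀ x ∈ s, VanishAtLeast F (m x) x) → n + 1 ≤ ∑ x ∈ s, m x → F = 0) : IsECOn n a J := by
  intro F hF hne r xs m hxs hinj _ _ hv
  by_contra hcon
  apply hne
  refine h F hF (Finset.univ.map ⟨xs, hinj⟩) (Function.extend xs m 0) ?_ ?_ ?_
  · intro x hx
    obtain ⟨i, -, rfl⟩ := Finset.mem_map.1 hx
    exact hxs i
  · intro x hx
    obtain ⟨i, -, rfl⟩ := Finset.mem_map.1 hx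
    simp only [Function.Embedding.coeFn_mk, hinj.extend_apply]
    exact hv i
  · rw [Finset.sum_map]
    simp only [Function.Embedding.coeFn_mk, hinj.extend_apply]
    omega

theorem EC_small (n : ℕ) (a : Fin (n + 1) → ℝ) : ∃ h : ℝ, 0 < h ∧ IsECOn n a (Set.Icc 0 h) := by
  set A := ∑ i, |a i| with hA
  have hA0 : 0 ≤ A := Finset.sum_nonneg fun i _ => abs_nonneg _
  set h := 1 / (A + 1) with hh
  have hpos : 0 < h := by positivity
  have hle : h ≤ 1 := by rw [hh, div_le_one (by positivity)]; linarith
  have hAh : A * h < 1 := by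
    rw [hh, mul_one_div, div_lt_one (by positivity)]; linarith
  refine ⟨h, hpos, EC_of_finset ?_⟩
  intro F hF s m hs hv hsum
  have hz := rolle_all (Set.Icc 0 h) Set.ordConnected_Icc n F hF.1 s m hs hv hsum
  obtain ⟨x1, hx1, hmax⟩ := isCompact_Icc.exists_isMaxOn (s := Set.Icc 0 h)
    ⟨0, le_rfl, hpos.le⟩ (f := fun x => |iteratedDeriv (n + 1) F x|)
    (smooth_iter hF.1 (n + 1)).continuous.abs.continuousOn
  set B := |iteratedDeriv (n + 1) F x1| with hB
  have hB0 : 0 ≤ B := abs_nonneg _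
  have hstep : ∀ j ≤ n, (∀ x ∈ Set.Icc 0 h, |iteratedDeriv (j + 1) F x| ≤ B) →
      ∀ x ∈ Set.Icc 0 h, |iteratedDeriv j F x| ≤ B * h := by
    intro j hj hb x hx
    obtain ⟨z, hzI, hz0⟩ := hz j hj
    have := Convex.norm_image_sub_le_of_norm_deriv_le (f := iteratedDeriv j F)
      (s := Set.Icc 0 h) (C := B) (x := z) (y := x)
      (fun y _ => (iter_hasDerivAt hF.1 j y).differentiableAt)
      (fun y hy => by rw [(iter_hasDerivAt hF.1 j y).deriv]; exact hb y hy)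
      (convex_Icc 0 h) hzI hx
    rw [hz0, sub_zero] at this
    refine this.trans (mul_le_mul_of_nonneg_left ?_ hB0)
    rw [Real.norm_eq_abs, abs_le]
    constructor <;> linarith [hx.1, hx.2, hzI.1, hzI.2]
  have hall : ∀ d j, j + d = n + 1 → ∀ x ∈ Set.Icc 0 h, |iteratedDeriv j F x| ≤ B := by
    intro d
    induction d with
    | zero => rintro j rfl x hx; exact hmax hx
    | succ d ih =>
      intro j hj x hx
      refine (hstep j (by omega) (ih (j + 1) (by omega)) x hx).trans ?_
      nlinarith
  have hall' : ∀ j ≤ n, ∀ x ∈ Set.Icc 0 h, |iteratedDeriv j F x| ≤ B * h := fun j hj =>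
    hstep j hj (hall (n - j) (j + 1) (by omega))
  have hBle : B ≤ A * (B * h) := by
    have e : iteratedDeriv (n + 1) F x1 = -∑ i : Fin (n + 1), a i * iteratedDeriv (i : ℕ) F x1 := by
      linarith [hF.2 x1]
    rw [hA, Finset.sum_mul]
    refine (le_of_eq (by rw [hB, e, abs_neg])).trans ?_
    refine (Finset.abs_sum_le_sum_abs _ _).trans (Finset.sum_le_sum fun i _ => ?_)
    rw [abs_mul]
    exact mul_le_mul_of_nonneg_left (hall' i (by omega) x1 hx1) (abs_nonneg _)
  have hBz : B = 0 := by nlinarith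
  refine ker_unique hF (x₀ := 0) fun j hj => ?_
  have := hall (n + 1 - j) j (by omega) 0 ⟨le_rfl, hpos.le⟩
  rw [hBz] at this
  exact abs_nonpos_iff.1 this

theorem not_EC_of_zero {n : ℕ} {a : Fin (n + 1) → ℝ} {S : ℝ → ℝ} (hS : S ∈ kerOp n a)
    (hS0 : ∀ j < n, iteratedDeriv j S 0 = 0) (hSn : iteratedDeriv n S 0 = 1)
    {k : ℕ} (hk : k < n) {x h : ℝ} (hx : 0 < x) (hxh : x ≤ h) (hW : WronS S k x = 0) :
    ¬ IsECOn n a (Set.Icc 0 h) := by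
  intro hEC
  obtain ⟨v, hv, hv0⟩ := Matrix.exists_mulVec_eq_zero_iff.2 hW
  set c := ext0 k v with hc
  have hcz : ∀ j, k + 1 ≤ j → c j = 0 := fun j hj => by simp [hc, ext0]; omega
  have hF0 : comb S (k + 1) c ≠ 0 := by
    intro h0
    apply hv
    have := triangular hS0 hSn c (fun i hi => by
      rw [← Finset.sum_subset (Finset.range_subset_range.2 (show k + 1 ≤ n + 1 by omega))
        (fun j _ hj => by rw [hcz j (by simpa using hj), zero_mul]), ← comb_iter hS.1, h0]
      simp)
    funext j
    rw [← ext0_coe k v j]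
    exact this j (by omega)
  have := hEC _ (comb_ker hS (k + 1) c) hF0 2 ![0, x] ![n - k, k + 1]
    (by intro i; fin_cases i <;> refine ⟨?_, ?_⟩ <;> simp <;> linarith)
    (by
      intro i j hij
      fin_cases i <;> fin_cases j <;> simp at hij ⊢ <;> linarith)
    (by intro i; fin_cases i <;> simp <;> omega)
    (by intro i; fin_cases i <;> simp <;> omega)
    (by
      intro i
      fin_cases i
      · intro j hj
        simp at hj ⊢
        rw [comb_iter hS.1]
        apply Finset.sum_eq_zero
        intro l hl
        rw [hS0 _ (by simp at hl; omega), mul_zero]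
      · intro j hj
        simp at hj ⊢
        rw [comb_iter hS.1]
        have := congrFun hv0 ⟨j, by omega⟩
        rw [wron_mulVec] at this
        exact this)
  simp at this
  omega

theorem EC_of_ne_zero {n : ℕ} {a : Fin (n + 1) → ℝ} {S : ℝ → ℝ} (hS : S ∈ kerOp n a)
    (hS0 : ∀ j < n, iteratedDeriv j S 0 = 0) (hSn : iteratedDeriv n S 0 = 1)
    {z w : ℝ} (hzw : z < w) (hW : ∀ k < n, ∀ x, 0 < x → x < w → WronS S k x ≠ 0) :
    IsECOn n a (Set.Icc 0 z) := by
  apply EC_of_finset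
  intro F hF s m hs hv hsum
  set e := (w - z) / 2 with he
  have hG := ker_translate hF e
  obtain ⟨c, hc⟩ := ker_span hS hS0 hSn hG
  have key := polya (Set.Ioo 0 w) isOpen_Ioo Set.ordConnected_Ioo n (fun j => iteratedDeriv j S)
    (fun j x _ => (smooth_iter hS.1 j).contDiffAt) (by
      intro k hk x hx d hd
      change VanishAtLeast (comb S (k + 1) d) (k + 1) x at hd
      rcases Nat.lt_or_ge k n with hkn | hkn
      · by_contra hcon
        push Not at hcon
        obtain ⟨j, hj, hdj⟩ := hcon
        apply hW k hkn x hx.1 hx.2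
        apply Matrix.exists_mulVec_eq_zero_iff.1
        refine ⟨fun j => d j, fun h0 => hdj (congrFun h0 ⟨j, by omega⟩), ?_⟩
        funext i
        have := hd i i.2
        rw [comb_iter hS.1, Finset.sum_range] at this
        refine Eq.trans ?_ this
        simp only [Matrix.mulVec, dotProduct, Matrix.of_apply]
        exact Finset.sum_congr rfl fun j _ => mul_comm _ _
      · obtain rfl : k = n := by omega
        have h0 := ker_unique (comb_ker hS (k + 1) d) hd
        exact triangular hS0 hSn d (fun i hi => by rw [← comb_iter hS.1, h0]; simp))
    c (s.map ⟨fun x => x + e, add_left_injective e⟩) (fun x => m (x - e))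
    (by
      intro x hx
      obtain ⟨y, hy, rfl⟩ := Finset.mem_map.1 hx
      have := hs y hy
      simp only [Function.Embedding.coeFn_mk]
      constructor <;> linarith [this.1, this.2])
    (by
      intro x hx
      change VanishAtLeast (comb S (n + 1) c) _ _
      rw [← hc]
      obtain ⟨y, hy, rfl⟩ := Finset.mem_map.1 hx
      intro j hj
      rw [iteratedDeriv_comp_sub_const]
      simp only [Function.Embedding.coeFn_mk, add_sub_cancel_right] at hj ⊢
      exact hv y hy j hj)
    (by rw [Finset.sum_map]; simpa using hsum)
  have hz : (fun y => F (y - e)) = 0 := by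
    rw [hc]; funext y
    exact Finset.sum_eq_zero fun j hj => by rw [key j (by simp at hj; omega), zero_mul]
  funext y
  simpa using congrFun hz (y + e)

/-- Wronskian characterisation of the critical length: with `S` the solution
vanishing `n` times at `0` with `S^(n)(0) = 1`, and `W_k` the Wronskian of `(S, …, S^(k))`,
one has `ℓ_L = min_{0 ≤ k ≤ n-1} inf {h > 0 | W_k(h) = 0}` (with `inf ∅ = +∞`). -/
theorem stmt3 (n : ℕ) (hn : 1 ≤ n) (a : Fin (n + 1) → ℝ)
    (hnonreal : ∃ z : ℂ,
      z ^ (n + 1) + ∑ i : Fin (n + 1), (a i : ℂ) * z ^ (i : ℕ) = 0 ∧ z.im ≠ 0)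
    (S : ℝ → ℝ) (hS : S ∈ kerOp n a)
    (hS0 : ∀ j < n, iteratedDeriv j S 0 = 0) (hSn : iteratedDeriv n S 0 = 1) :
    critLen n a =
      ⨅ k : Fin n,
        sInf {l : EReal | ∃ h : ℝ, l = (h : EReal) ∧ 0 < h ∧ WronS S (k : ℕ) h = 0} := by
  apply le_antisymm
  · refine le_iInf fun k => le_sInf ?_
    rintro _ ⟨x, rfl, hx, hW⟩
    refine sSup_le ?_
    rintro _ ⟨h, rfl, hh, hEC⟩
    by_contra hcon
    push Not at hcon
    exact not_EC_of_zero hS hS0 hSn k.2 hx (EReal.coe_lt_coe_iff.1 hcon).le hW hEC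
  · refine le_of_forall_lt fun b hb => ?_
    obtain ⟨w, hbw, hw⟩ := EReal.lt_iff_exists_real_btwn.1 hb
    obtain ⟨z, hbz, hzw⟩ := EReal.lt_iff_exists_real_btwn.1 hbw
    have hzw' : z < w := EReal.coe_lt_coe_iff.1 hzw
    refine lt_of_lt_of_le hbz ?_
    by_cases hz : 0 < z
    · refine le_sSup ⟨z, rfl, hz, EC_of_ne_zero hS hS0 hSn hzw' ?_⟩
      intro k hk x hx hxw h0
      have h1 : (w : EReal) < x := lt_of_lt_of_le hw ((iInf_le _ (⟨k, hk⟩ : Fin n)).trans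
        (sInf_le ⟨x, rfl, hx, h0⟩))
      exact absurd (EReal.coe_lt_coe_iff.1 h1) (not_lt.2 hxw.le)
    · obtain ⟨h, hh, hEC⟩ := EC_small n a
      exact le_trans (EReal.coe_le_coe_iff.2 (by linarith)) (le_sSup ⟨h, rfl, hh, hEC⟩)
end
end
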